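/- arXiv:1507.00868 — 10 statements merged into one kernel-verified Lean document; each statement's English description precedes it below -/
import Mathlib

section
/- Edmonds' Disjoint Arborescence Theorem: Let D = (V, A) be a finite directed multigraph, r ∈ V a node, and k a positive integer. Then D contains k pairwise arc-disjoint spanning arborescences all rooted at r (i.e., a k-union-r-arborescence) if and only if ρ_D(X) ≥ k for every non-empty subset X ⊆ V − r. -/
/-!  A finite directed multigraph is modelled by a finite arc type `A`, a finite
vertex type `V`, and tail/head maps `tl hd : A → V`.  Arc subsets are `Finset A`,
the full digraph `D` corresponds to the arc set `Finset.univ`, and `D - H`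
corresponds to `Finset.univ \ H`. -/

/-- `rho tl hd B X` = number of arcs of `B` entering the vertex set `X`. -/
def rho {V A : Type*} [DecidableEq V] [Fintype A]
    (tl hd : A → V) (B : Finset A) (X : Finset V) : ℕ :=
  (B.filter fun a => tl a ∉ X ∧ hd a ∈ X).card

/-- weighted in-degree of a vertex set. -/
def rhoW {V A : Type*} [DecidableEq V] [Fintype A]
    (tl hd : A → V) (w : A → ℝ) (B : Finset A) (X : Finset V) : ℝ :=
  ∑ a ∈ B.filter (fun a => tl a ∉ X ∧ hd a ∈ X), w a

/-- one step along an arc of `B`. -/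
def Step {V A : Type*} (tl hd : A → V) (B : Finset A) (u v : V) : Prop :=
  ∃ a ∈ B, tl a = u ∧ hd a = v

/-- `B` is a spanning arborescence rooted at `r`: `r` has in-degree `0` in `B`,
every other vertex has in-degree `1` in `B`, and every vertex is reachable
from `r` along arcs of `B`. -/
def IsRArbor {V A : Type*} [DecidableEq V] [Fintype A]
    (tl hd : A → V) (B : Finset A) (r : V) : Prop :=
  rho tl hd B {r} = 0 ∧ (∀ v : V, v ≠ r → rho tl hd B {v} = 1) ∧
    ∀ v : V, Relation.ReflTransGen (Step tl hd B) r v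

/-- `B` is a spanning arborescence (with some root). -/
def IsArbor {V A : Type*} [DecidableEq V] [Fintype A]
    (tl hd : A → V) (B : Finset A) : Prop :=
  ∃ r : V, IsRArbor tl hd B r

/-- `B` is the arc-disjoint union of `k` spanning arborescences. -/
def IsKUnionArbor {V A : Type*} [DecidableEq V] [Fintype A] [DecidableEq A]
    (tl hd : A → V) (k : ℕ) (B : Finset A) : Prop :=
  ∃ f : Fin k → Finset A, (∀ i, IsArbor tl hd (f i)) ∧
    (∀ i j, i ≠ j → Disjoint (f i) (f j)) ∧ B = Finset.univ.biUnion f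

/-- `B` is the arc-disjoint union of `k` spanning arborescences rooted at `r`. -/
def IsKUnionRArbor {V A : Type*} [DecidableEq V] [Fintype A] [DecidableEq A]
    (tl hd : A → V) (k : ℕ) (r : V) (B : Finset A) : Prop :=
  ∃ f : Fin k → Finset A, (∀ i, IsRArbor tl hd (f i) r) ∧
    (∀ i j, i ≠ j → Disjoint (f i) (f j)) ∧ B = Finset.univ.biUnion f

/-- the digraph with arc set `S` contains a `k`-union-arborescence. -/
def HasKUnionArborOn {V A : Type*} [DecidableEq V] [Fintype A] [DecidableEq A]
    (tl hd : A → V) (S : Finset A) (k : ℕ) : Prop :=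
  ∃ B : Finset A, B ⊆ S ∧ IsKUnionArbor tl hd k B

/-- the digraph with arc set `S` contains a `k`-union-`r`-arborescence. -/
def HasKUnionRArborOn {V A : Type*} [DecidableEq V] [Fintype A] [DecidableEq A]
    (tl hd : A → V) (S : Finset A) (k : ℕ) (r : V) : Prop :=
  ∃ B : Finset A, B ⊆ S ∧ IsKUnionRArbor tl hd k r B

/-- a subpartition of `V'`: a collection of pairwise disjoint non-empty subsets of `V'`. -/
def IsSubpartition {V : Type*} [DecidableEq V]
    (V' : Finset V) (P : Finset (Finset V)) : Prop :=
  (∀ X ∈ P, X.Nonempty ∧ X ⊆ V') ∧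
    ∀ X ∈ P, ∀ Y ∈ P, X ≠ Y → Disjoint X Y

/-- `X` is an in-solid set of the digraph: it is non-empty and every non-empty
proper subset has strictly larger in-degree. -/
def Insolid {V A : Type*} [DecidableEq V] [Fintype A]
    (tl hd : A → V) (X : Finset V) : Prop :=
  X.Nonempty ∧ ∀ Y : Finset V, Y.Nonempty → Y ⊂ X →
    rho tl hd Finset.univ X < rho tl hd Finset.univ Y

/-- `X` is an in-solid set of the arc-weighted digraph `(tl, hd, w)`. -/
def InsolidW {V A : Type*} [DecidableEq V] [Fintype A]
    (tl hd : A → V) (w : A → ℝ) (X : Finset V) : Prop :=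
  X.Nonempty ∧ ∀ Y : Finset V, Y.Nonempty → Y ⊂ X →
    rhoW tl hd w Finset.univ X < rhoW tl hd w Finset.univ Y

/-- `C` is (the vertex set of) a connected component of the graph `G`. -/
def IsCompOf {V : Type*} (G : SimpleGraph V) (C : Set V) : Prop :=
  ∃ v : V, C = {u | G.Reachable v u}

section Arborescences

variable {V A : Type*} {tl hd : A → V}

theorem exists_mem_enters_of_reachable {B : Finset A} {X : Finset V} {u v : V}
    (h : Relation.ReflTransGen (Step tl hd B) u v) (hu : u ∉ X) (hv : v ∈ X) :
    ∃ a ∈ B, tl a ∉ X ∧ hd a ∈ X := by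
  induction h with
  | refl => exact absurd hv hu
  | @tail b c _ hbc ih =>
    obtain ⟨a, ha, rfl, rfl⟩ := hbc
    by_cases hb : tl a ∈ X
    · exact ih hb
    · exact ⟨a, ha, hb, hv⟩

variable [DecidableEq V] [Fintype A]

theorem rho_pos_iff {B : Finset A} {X : Finset V} :
    0 < rho tl hd B X ↔ ∃ a ∈ B, tl a ∉ X ∧ hd a ∈ X := by
  simp [rho, Finset.card_pos, Finset.Nonempty]

theorem rho_eq_sum (B : Finset A) (X : Finset V) :
    rho tl hd B X = ∑ a ∈ B, if tl a ∉ X ∧ hd a ∈ X then 1 else 0 :=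
  Finset.card_filter _ _

theorem rho_inter_add_rho_union_le (B : Finset A) (X Y : Finset V) :
    rho tl hd B (X ∩ Y) + rho tl hd B (X ∪ Y) ≤ rho tl hd B X + rho tl hd B Y := by
  simp only [rho_eq_sum, ← Finset.sum_add_distrib]
  refine Finset.sum_le_sum fun a _ => ?_
  by_cases h₁ : tl a ∈ X <;> by_cases h₂ : tl a ∈ Y <;> by_cases h₃ : hd a ∈ X <;>
    by_cases h₄ : hd a ∈ Y <;> simp [h₁, h₂, h₃, h₄]

theorem rho_sdiff_of_forall_head_notMem [DecidableEq A] {B F : Finset A} {X : Finset V}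
    (h : ∀ a ∈ F, hd a ∉ X) : rho tl hd (B \ F) X = rho tl hd B X := by
  unfold rho
  congr 1
  grind

theorem rho_insert_of_head_notMem [DecidableEq A] {B : Finset A} {X : Finset V} {e : A}
    (h : hd e ∉ X) : rho tl hd (insert e B) X = rho tl hd B X := by
  unfold rho
  rw [Finset.filter_insert, if_neg (by tauto)]

theorem rho_le_rho_sdiff_insert_add_one [DecidableEq A] (B F : Finset A) (e : A)
    (X : Finset V) : rho tl hd (B \ F) X ≤ rho tl hd (B \ insert e F) X + 1 := by
  unfold rho
  rw [Finset.sdiff_insert, Finset.filter_erase]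
  exact Nat.sub_le_iff_le_add.mp Finset.pred_card_le_card_erase

theorem rho_sdiff_insert_of_not_enters [DecidableEq A] {B F : Finset A} {e : A}
    {X : Finset V} (h : ¬(tl e ∉ X ∧ hd e ∈ X)) :
    rho tl hd (B \ insert e F) X = rho tl hd (B \ F) X := by
  unfold rho
  congr 1
  grind

/-- `F` is an arborescence rooted at `r` that spans `T`, all of whose arcs have head in `T`. -/
structure IsPartialArbor (tl hd : A → V) (r : V) (T : Finset V) (F : Finset A) : Prop where
  root_mem : r ∈ T
  head_mem : ∀ a ∈ F, hd a ∈ T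
  rho_root : rho tl hd F {r} = 0
  rho_eq_one : ∀ v ∈ T, v ≠ r → rho tl hd F {v} = 1
  reachable : ∀ v ∈ T, Relation.ReflTransGen (Step tl hd F) r v

theorem isPartialArbor_singleton (r : V) : IsPartialArbor tl hd r {r} ∅ where
  root_mem := Finset.mem_singleton_self r
  head_mem := by simp
  rho_root := by simp [rho]
  rho_eq_one := by simp
  reachable := by simp [Relation.ReflTransGen.refl]

theorem IsPartialArbor.insert_arc [DecidableEq A] {r : V} {T : Finset V} {F : Finset A}
    (h : IsPartialArbor tl hd r T F) {e : A} (ht : tl e ∈ T) (hh : hd e ∉ T) :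
    IsPartialArbor tl hd r (insert (hd e) T) (insert e F) where
  root_mem := Finset.mem_insert_of_mem h.root_mem
  head_mem := by
    have := h.head_mem
    grind
  rho_root := by
    rw [rho_insert_of_head_notMem, h.rho_root]
    rw [Finset.mem_singleton]
    rintro rfl
    exact hh h.root_mem
  rho_eq_one v hv hvr := by
    rcases Finset.mem_insert.mp hv with rfl | hv
    · unfold rho
      rw [Finset.card_eq_one]
      refine ⟨e, ?_⟩
      have := h.head_mem
      ext a
      simp only [Finset.mem_filter, Finset.mem_insert, Finset.mem_singleton]
      grind
    · rw [rho_insert_of_head_notMem, h.rho_eq_one v hv hvr]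
      rw [Finset.mem_singleton]
      rintro rfl
      exact hh hv
  reachable v hv := by
    have mono : ∀ w ∈ T, Relation.ReflTransGen (Step tl hd (insert e F)) r w :=
      fun w hw => Relation.ReflTransGen.mono
        (fun _ _ ⟨a, ha, hab⟩ => ⟨a, Finset.mem_insert_of_mem ha, hab⟩) _ _ (h.reachable w hw)
    rcases Finset.mem_insert.mp hv with rfl | hv
    · exact (mono _ ht).tail ⟨e, Finset.mem_insert_self e F, rfl, rfl⟩
    · exact mono v hv

/-- Lovász's extension step: a partial arborescence whose removal keeps all in-degrees at
least `k` can be extended by an arc without violating this. -/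
theorem IsPartialArbor.exists_extension [Fintype V] [DecidableEq A] {r : V} {k : ℕ}
    {B F : Finset A} {T : Finset V} (h : IsPartialArbor tl hd r T F)
    (hB : ∀ X : Finset V, X.Nonempty → r ∉ X → k + 1 ≤ rho tl hd B X)
    (hF : ∀ X : Finset V, X.Nonempty → r ∉ X → k ≤ rho tl hd (B \ F) X)
    (hT : T ≠ Finset.univ) :
    ∃ e ∈ B, tl e ∈ T ∧ hd e ∉ T ∧
      ∀ X : Finset V, X.Nonempty → r ∉ X → k ≤ rho tl hd (B \ insert e F) X := by
  have hFB : ∀ X : Finset V, Disjoint X T → rho tl hd (B \ F) X = rho tl hd B X :=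
    fun X hX => rho_sdiff_of_forall_head_notMem fun a ha haX =>
      Finset.disjoint_left.mp hX haX (h.head_mem a ha)
  by_cases hX : ∃ X : Finset V, r ∉ X ∧ rho tl hd (B \ F) X = k ∧ ¬X ⊆ T
  · obtain ⟨X, ⟨hrX, hXk, hXT⟩, hmin⟩ := exists_minimal_of_wellFoundedLT
      (fun X : Finset V => r ∉ X ∧ rho tl hd (B \ F) X = k ∧ ¬X ⊆ T) hX
    have hlt : rho tl hd (B \ F) X < rho tl hd (B \ F) (X \ T) := by
      rw [hXk, hFB _ Finset.sdiff_disjoint]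
      exact hB _ (Finset.sdiff_nonempty.mpr hXT) fun hr => hrX (Finset.mem_sdiff.mp hr).1
    obtain ⟨e, he, he'⟩ := Finset.exists_mem_notMem_of_card_lt_card hlt
    simp only [Finset.mem_filter, Finset.mem_sdiff] at he he'
    have htX : tl e ∈ X := by tauto
    have hhX : hd e ∈ X := he.2.2.1
    have hhT : hd e ∉ T := he.2.2.2
    refine ⟨e, he.1.1, by tauto, hhT, fun Y hY hrY => ?_⟩
    by_cases hent : tl e ∉ Y ∧ hd e ∈ Y
    · have hne : rho tl hd (B \ F) Y ≠ k := by
        intro hYk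
        have hsub := rho_inter_add_rho_union_le (tl := tl) (hd := hd) (B \ F) X Y
        have hmem : hd e ∈ X ∩ Y := Finset.mem_inter.mpr ⟨hhX, hent.2⟩
        have hrI : r ∉ X ∩ Y := fun hr => hrX (Finset.mem_inter.mp hr).1
        have hrU : r ∉ X ∪ Y := by simp [hrX, hrY]
        have hI := hF (X ∩ Y) ⟨_, hmem⟩ hrI
        have hU := hF (X ∪ Y) (hY.mono Finset.subset_union_right) hrU
        have hle := hmin (y := X ∩ Y) ⟨hrI, by omega, fun hs => hhT (hs hmem)⟩
          Finset.inter_subset_left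
        exact hent.1 (Finset.mem_inter.mp (hle htX)).2
      have := hF Y hY hrY
      have := rho_le_rho_sdiff_insert_add_one (tl := tl) (hd := hd) B F e Y
      omega
    · rw [rho_sdiff_insert_of_not_enters hent]
      exact hF Y hY hrY
  · push Not at hX
    have hpos : 0 < rho tl hd B Tᶜ :=
      (Nat.succ_pos k).trans_le (hB _ (by
        rwa [Finset.nonempty_iff_ne_empty, Ne, Finset.compl_eq_empty_iff])
        (by simp [h.root_mem]))
    obtain ⟨e, he, ht, hh⟩ := rho_pos_iff.mp hpos
    rw [Finset.mem_compl, not_not] at ht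
    rw [Finset.mem_compl] at hh
    refine ⟨e, he, ht, hh, fun Y hY hrY => ?_⟩
    by_cases hhY : hd e ∈ Y
    · have := hF Y hY hrY
      have := mt (hX Y hrY) fun hs => hh (hs hhY)
      have := rho_le_rho_sdiff_insert_add_one (tl := tl) (hd := hd) B F e Y
      omega
    · rw [rho_sdiff_insert_of_not_enters fun hent => hhY hent.2]
      exact hF Y hY hrY

theorem exists_isRArbor_subset_le_rho_sdiff [Fintype V] [DecidableEq A] {r : V} {k : ℕ}
    {B : Finset A} (hB : ∀ X : Finset V, X.Nonempty → r ∉ X → k + 1 ≤ rho tl hd B X) :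
    ∃ F ⊆ B, IsRArbor tl hd F r ∧
      ∀ X : Finset V, X.Nonempty → r ∉ X → k ≤ rho tl hd (B \ F) X := by
  obtain ⟨T, ⟨F, hFB, hTF, hF⟩, hmax⟩ := exists_maximal_of_wellFoundedGT
    (fun T : Finset V => ∃ F ⊆ B, IsPartialArbor tl hd r T F ∧
      ∀ X : Finset V, X.Nonempty → r ∉ X → k ≤ rho tl hd (B \ F) X)
    ⟨{r}, ∅, Finset.empty_subset B, isPartialArbor_singleton r, fun X hX hr => by
      simpa using (Nat.le_succ k).trans (hB X hX hr)⟩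
  have hT : T = Finset.univ := by
    by_contra hT
    obtain ⟨e, heB, ht, hh, he⟩ := hTF.exists_extension hB hF hT
    exact hh (hmax ⟨insert e F, Finset.insert_subset heB hFB, hTF.insert_arc ht hh, he⟩
      (Finset.subset_insert _ _) (Finset.mem_insert_self _ _))
  subst hT
  exact ⟨F, hFB, ⟨hTF.rho_root, fun v => hTF.rho_eq_one v (Finset.mem_univ v),
    fun v => hTF.reachable v (Finset.mem_univ v)⟩, hF⟩

theorem exists_disjoint_isRArbor [Fintype V] [DecidableEq A] {r : V} (k : ℕ)
    {B : Finset A} (hB : ∀ X : Finset V, X.Nonempty → r ∉ X → k ≤ rho tl hd B X) :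
    ∃ f : Fin k → Finset A, (∀ i, f i ⊆ B) ∧ (∀ i, IsRArbor tl hd (f i) r) ∧
      ∀ i j, i ≠ j → Disjoint (f i) (f j) := by
  induction k generalizing B with
  | zero => exact ⟨fun _ => ∅, fun i => i.elim0, fun i => i.elim0, fun i => i.elim0⟩
  | succ k ih =>
    obtain ⟨F, hFB, hF, hk⟩ := exists_isRArbor_subset_le_rho_sdiff hB
    obtain ⟨f, hfB, hf, hdisj⟩ := ih hk
    have hFf : ∀ i, Disjoint F (f i) := fun i =>
      Finset.disjoint_sdiff.mono_right (hfB i)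
    refine ⟨Fin.cons F f, Fin.cases hFB fun i => (hfB i).trans Finset.sdiff_subset,
      Fin.cases hF hf, Fin.cases (Fin.cases (fun h => absurd rfl h) fun j _ => hFf j)
        fun i => Fin.cases (fun _ => (hFf i).symm) fun j hij => hdisj i j fun h => hij (h ▸ rfl)⟩

theorem le_rho_of_disjoint_isRArbor {r : V} {k : ℕ} {f : Fin k → Finset A}
    (hf : ∀ i, IsRArbor tl hd (f i) r) (hdisj : ∀ i j, i ≠ j → Disjoint (f i) (f j))
    {X : Finset V} (hX : X.Nonempty) (hr : r ∉ X) : k ≤ rho tl hd Finset.univ X := by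
  obtain ⟨v, hv⟩ := hX
  choose g hg hgX using fun i => exists_mem_enters_of_reachable ((hf i).2.2 v) hr hv
  have hinj : Function.Injective g := fun i j hij => by
    by_contra hne
    exact Finset.disjoint_left.mp (hdisj i j hne) (hg i) (hij ▸ hg j)
  calc k = (Finset.univ.map ⟨g, hinj⟩).card := by simp
    _ ≤ rho tl hd Finset.univ X := Finset.card_le_card fun a ha => by
      obtain ⟨i, -, rfl⟩ := Finset.mem_map.mp ha
      simpa using hgX i

end Arborescences

/-- **Edmonds' Disjoint Arborescence Theorem.**  A finite directed multigraph `D`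
contains `k` pairwise arc-disjoint spanning arborescences all rooted at `r`
iff every non-empty vertex set avoiding `r` has in-degree at least `k`. -/
theorem edmonds_disjoint_arborescences
    {V A : Type*} [Fintype V] [DecidableEq V] [Fintype A] [DecidableEq A]
    (tl hd : A → V) (r : V) (k : ℕ) (hk : 0 < k) :
    (∃ B : Finset A, IsKUnionRArbor tl hd k r B) ↔
      ∀ X : Finset V, X.Nonempty → r ∉ X → k ≤ rho tl hd Finset.univ X := by
  constructor
  · rintro ⟨_, f, hf, hdisj, -⟩ X hX hr
    exact le_rho_of_disjoint_isRArbor hf hdisj hX hr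
  · intro h
    obtain ⟨f, -, hf, hdisj⟩ := exists_disjoint_isRArbor k h
    exact ⟨_, f, hf, hdisj, rfl⟩
end

section
/- Given a finite directed multigraph D = (V, A) and an arbitrary non-empty subset X ⊆ V, there exists an insolid set X′ ⊆ X such that ρ_D(X′) ≤ ρ_D(X). -/
/-- Every non-empty vertex set `X` contains an in-solid set `X'` with
`ρ(X') ≤ ρ(X)`. -/
theorem exists_insolid_subset
    {V A : Type*} [Fintype V] [DecidableEq V] [Fintype A] [DecidableEq A]
    (tl hd : A → V) (X : Finset V) (hX : X.Nonempty) :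
    ∃ X' : Finset V, X' ⊆ X ∧ Insolid tl hd X' ∧
      rho tl hd Finset.univ X' ≤ rho tl hd Finset.univ X := by
  induction X using Finset.strongInduction with
  | H X ih =>
    by_cases h : Insolid tl hd X
    · exact ⟨X, subset_rfl, h, le_rfl⟩
    · obtain ⟨Y, hY, hYX, hle⟩ : ∃ Y : Finset V, Y.Nonempty ∧ Y ⊂ X ∧
          rho tl hd Finset.univ Y ≤ rho tl hd Finset.univ X := by
        by_contra! hlt
        exact h ⟨hX, hlt⟩
      obtain ⟨X', hX'Y, hX', hle'⟩ := ih Y hYX hY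
      exact ⟨X', hX'Y.trans hYX.subset, hX', hle'.trans hle⟩
end

section
/- Bárász–Becker–Frank subtree representation: For every finite directed multigraph D = (V, A), the family of insolid sets of D is a subtree hypergraph; that is, there exists a tree T spanning the vertex set V such that every insolid set of D induces a connected subgraph (subtree) of T. -/
section Chordal

variable {α : Type*} {M : α → α → Prop}

/-- Dirac's theorem: in a reflexive symmetric relation whose minimal separators are cliques, every
non-universal element `r` of a finite set `G` misses some simplicial element of `G`. -/
lemma exists_simplicial_of_not_universal [DecidableEq α] (hrefl : ∀ a, M a a)
    (hsymm : ∀ a b, M a b → M b a)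
    (hsep : ∀ r b b' c c', M r b → M r b' → M b c → M b' c' → ¬ M r c →
      Relation.ReflTransGen (fun x y => M x y ∧ ¬ M r y) c c' → M b b')
    (G : Finset α) :
    ∀ r ∈ G, (∃ x ∈ G, ¬ M r x) →
      ∃ s ∈ G, ¬ M r s ∧ ∀ y ∈ G, ∀ z ∈ G, M s y → M s z → M y z := by
  classical
  induction G using Finset.strongInduction with
  | H G ih =>
    rintro r hr ⟨x, hx, hrx⟩
    let E : α → α → Prop := fun a b => (a ∈ G ∧ ¬ M r a) ∧ (b ∈ G ∧ ¬ M r b) ∧ M a b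
    have hEsymm : Std.Symm E := ⟨fun a b h => ⟨h.2.1, h.1, hsymm _ _ h.2.2⟩⟩
    let C := G.filter fun c => Relation.ReflTransGen E x c
    let B := G.filter fun b => M r b ∧ ∃ c ∈ C, M b c
    have hCG : ∀ c ∈ C, c ∈ G := fun c hc => (Finset.mem_filter.1 hc).1
    have hBG : ∀ c ∈ B, c ∈ G := fun c hc => (Finset.mem_filter.1 hc).1
    have hCr : ∀ c ∈ C, ¬ M r c := by
      intro c hc
      rcases Relation.ReflTransGen.cases_tail (Finset.mem_filter.1 hc).2 with h | ⟨d, _, h⟩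
      · exact h ▸ hrx
      · exact h.2.1.2
    have hclosed : ∀ c ∈ C, ∀ y ∈ G, M c y → y ∈ C ∪ B := by
      intro c hc y hy hcy
      rw [Finset.mem_union]
      by_cases hry : M r y
      · exact Or.inr (Finset.mem_filter.2 ⟨hy, hry, c, hc, hsymm _ _ hcy⟩)
      · exact Or.inl (Finset.mem_filter.2 ⟨hy, (Finset.mem_filter.1 hc).2.tail
          ⟨⟨hCG c hc, hCr c hc⟩, ⟨hy, hry⟩, hcy⟩⟩)
    have hBclique : ∀ b ∈ B, ∀ b' ∈ B, M b b' := by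
      intro b hb b' hb'
      obtain ⟨_, hrb, c, hc, hbc⟩ := Finset.mem_filter.1 hb
      obtain ⟨_, hrb', c', hc', hbc'⟩ := Finset.mem_filter.1 hb'
      refine hsep r b b' c c' hrb hrb' hbc hbc' (hCr c hc) ?_
      have hxc : Relation.ReflTransGen E c x := symm (Finset.mem_filter.1 hc).2
      exact Relation.ReflTransGen.mono (fun a b (h : E a b) => ⟨h.2.2, h.2.1.2⟩) _ _
        (hxc.trans (Finset.mem_filter.1 hc').2)
    have hHG : C ∪ B ⊂ G := by
      refine (Finset.ssubset_iff_of_subset ?_).2 ⟨r, hr, ?_⟩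
      · exact Finset.union_subset hCG hBG
      · rw [Finset.mem_union]
        rintro (h | h)
        · exact hCr r h (hrefl r)
        · obtain ⟨_, _, c, hc, hrc⟩ := Finset.mem_filter.1 h
          exact hCr c hc hrc
    have hxC : x ∈ C := Finset.mem_filter.2 ⟨hx, .refl⟩
    have lift : ∀ s ∈ C, (∀ y ∈ C ∪ B, ∀ z ∈ C ∪ B, M s y → M s z → M y z) →
        ∃ s ∈ G, ¬ M r s ∧ ∀ y ∈ G, ∀ z ∈ G, M s y → M s z → M y z := fun s hs h =>
      ⟨s, hCG s hs, hCr s hs, fun y hy z hz hsy hsz =>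
        h y (hclosed s hs y hy hsy) z (hclosed s hs z hz hsz) hsy hsz⟩
    by_cases hB : ∃ b ∈ B, ∃ y ∈ C ∪ B, ¬ M b y
    · obtain ⟨b, hb, y, hy, hby⟩ := hB
      obtain ⟨s, hs, hbs, h⟩ := ih _ hHG b (Finset.mem_union_right _ hb) ⟨y, hy, hby⟩
      exact lift s ((Finset.mem_union.1 hs).resolve_right fun h => hbs (hBclique b hb s h)) h
    · push Not at hB
      by_cases hC : ∃ c ∈ C, ∃ y ∈ C ∪ B, ¬ M c y
      · obtain ⟨c, hc, y, hy, hcy⟩ := hC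
        obtain ⟨s, hs, hcs, h⟩ := ih _ hHG c (Finset.mem_union_left _ hc) ⟨y, hy, hcy⟩
        exact lift s ((Finset.mem_union.1 hs).resolve_right fun h =>
          hcs (hsymm _ _ (hB s h c (Finset.mem_union_left _ hc)))) h
      · push Not at hC
        refine lift x hxC fun y hy z hz _ _ => ?_
        rcases Finset.mem_union.1 hy with h | h
        · exact hC y h z hz
        · exact hB y h z hz

lemma exists_simplicial [DecidableEq α] (hrefl : ∀ a, M a a)
    (hsymm : ∀ a b, M a b → M b a)
    (hsep : ∀ r b b' c c', M r b → M r b' → M b c → M b' c' → ¬ M r c →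
      Relation.ReflTransGen (fun x y => M x y ∧ ¬ M r y) c c' → M b b')
    (G : Finset α) (hG : G.Nonempty) :
    ∃ s ∈ G, ∀ y ∈ G, ∀ z ∈ G, M s y → M s z → M y z := by
  by_cases h : ∃ r ∈ G, ∃ x ∈ G, ¬ M r x
  · obtain ⟨r, hr, hx⟩ := h
    obtain ⟨s, hs, -, h⟩ := exists_simplicial_of_not_universal hrefl hsymm hsep G r hr hx
    exact ⟨s, hs, h⟩
  · push Not at h
    obtain ⟨s, hs⟩ := hG
    exact ⟨s, hs, fun y hy z hz _ _ => h y hy z hz⟩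

lemma exists_seq_of_reflTransGen {E : α → α → Prop} {a b : α}
    (h : Relation.ReflTransGen E a b) :
    ∃ (k : ℕ) (p : ℕ → α), p 0 = a ∧ p k = b ∧ ∀ i < k, E (p i) (p (i + 1)) := by
  induction h using Relation.ReflTransGen.head_induction_on with
  | refl => exact ⟨0, fun _ => b, rfl, rfl, by simp⟩
  | @head a c hac _ ih =>
    obtain ⟨k, p, h0, hk, hp⟩ := ih
    refine ⟨k + 1, fun i => if i = 0 then a else p (i - 1), by simp, by simpa using hk, ?_⟩
    rintro (_ | i) hi
    · simpa [h0] using hac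
    · simpa using hp i (by omega)

end Chordal

section Insolid

variable {V A : Type*} [DecidableEq V] [Fintype A] {tl hd : A → V}

/-- If disjoint sets `Y i` are such that every arc entering some `Y i` enters some `X j`, then
the total in-degree of the `Y i` is at most that of the `X i`. -/
lemma sum_rho_le_sum_rho {ι : Type*} (s : Finset ι) (X Y : ι → Finset V)
    (hdisj : ∀ i ∈ s, ∀ j ∈ s, i ≠ j → Disjoint (Y i) (Y j))
    (hent : ∀ i ∈ s, ∀ u v, v ∈ Y i → u ∉ Y i → ∃ j ∈ s, v ∈ X j ∧ u ∉ X j) :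
    ∑ i ∈ s, rho tl hd Finset.univ (Y i) ≤ ∑ i ∈ s, rho tl hd Finset.univ (X i) := by
  classical
  unfold rho
  simp only [Finset.card_filter]
  rw [Finset.sum_comm, Finset.sum_comm (s := s)]
  refine Finset.sum_le_sum fun a _ => ?_
  rw [← Finset.card_filter, ← Finset.card_filter]
  by_cases h : ∃ i ∈ s, tl a ∉ Y i ∧ hd a ∈ Y i
  · obtain ⟨i, hi, hu, hv⟩ := h
    obtain ⟨j, hj, hvj, huj⟩ := hent i hi _ _ hv hu
    have h1 : 0 < (s.filter fun i => tl a ∉ X i ∧ hd a ∈ X i).card :=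
      Finset.card_pos.2 ⟨j, Finset.mem_filter.2 ⟨hj, huj, hvj⟩⟩
    refine le_trans (Finset.card_le_one.2 fun c hc d hd' => ?_) h1
    rw [Finset.mem_filter] at hc hd'
    by_contra hne
    exact Finset.disjoint_left.1 (hdisj c hc.1 d hd'.1 hne) hc.2.2 hd'.2.2
  · push Not at h
    rw [Finset.filter_eq_empty_iff.2 fun i hi hc => h i hi hc.1 hc.2]
    simp

/-- In-solid sets have the Helly property. -/
lemma exists_mem_of_pairwise_inter (G : Finset (Finset V)) (hne : G.Nonempty)
    (hG : ∀ X ∈ G, Insolid tl hd X) (hint : ∀ X ∈ G, ∀ Y ∈ G, (X ∩ Y).Nonempty) :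
    ∃ v, ∀ X ∈ G, v ∈ X := by
  induction G using Finset.strongInduction with
  | H G ih =>
    by_contra hno
    obtain ⟨Z, hZ, hmax⟩ := G.exists_max_image (rho tl hd Finset.univ) hne
    obtain ⟨z, hz⟩ := (hG Z hZ).1
    obtain ⟨W, hW, hWZ⟩ : ∃ W ∈ G, W ≠ Z := by
      by_contra! h
      exact hno ⟨z, fun X hX => h X hX ▸ hz⟩
    let Y : Finset V → Finset V := fun X => (if X = Z then W else Z).filter
      fun v => ∀ K ∈ G, K ≠ X → v ∈ K
    have hY : ∀ X v, v ∈ Y X ↔ ∀ K ∈ G, K ≠ X → v ∈ K := by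
      intro X v
      simp only [Y, Finset.mem_filter, and_iff_right_iff_imp]
      intro h
      split_ifs with hX
      · exact h W hW (hX ▸ hWZ)
      · exact h Z hZ (Ne.symm hX)
    have hYne : ∀ X ∈ G, (Y X).Nonempty := by
      intro X hX
      obtain ⟨v, hv⟩ := ih (G.erase X) (Finset.erase_ssubset hX)
        (by
          by_cases h : X = Z
          · exact ⟨W, Finset.mem_erase.2 ⟨h ▸ hWZ, hW⟩⟩
          · exact ⟨Z, Finset.mem_erase.2 ⟨Ne.symm h, hZ⟩⟩)
        (fun K hK => hG K (Finset.mem_of_mem_erase hK))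
        (fun K hK L hL => hint K (Finset.mem_of_mem_erase hK) L (Finset.mem_of_mem_erase hL))
      exact ⟨v, (hY X v).2 fun K hK hKX => hv K (Finset.mem_erase.2 ⟨hKX, hK⟩)⟩
    have hlt : ∀ X ∈ G, ∀ K ∈ G, K ≠ X →
        rho tl hd Finset.univ K < rho tl hd Finset.univ (Y X) := by
      intro X hX K hK hKX
      refine (hG K hK).2 _ (hYne X hX) ((Finset.ssubset_iff_subset_ne).2
        ⟨fun v hv => (hY X v).1 hv K hK hKX, fun h => ?_⟩)
      obtain ⟨v, hv⟩ := hint X hX K hK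
      rw [Finset.mem_inter] at hv
      refine hno ⟨v, fun L hL => ?_⟩
      by_cases hLX : L = X
      · exact hLX ▸ hv.1
      · exact (hY X v).1 (h ▸ hv.2) L hL hLX
    let σ := Equiv.swap Z W
    have hσ : ∀ X ∈ G, σ X ∈ G := by
      intro X hX
      simp only [σ, Equiv.swap_apply_def]
      split_ifs <;> assumption
    refine absurd (sum_rho_le_sum_rho (tl := tl) (hd := hd) G id (fun X => Y (σ X)) ?_ ?_)
      (not_le.2 (Finset.sum_lt_sum_of_nonempty hne ?_))
    · intro X hX X' hX' hXX'
      rw [Finset.disjoint_left]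
      intro v hv hv'
      rw [hY] at hv hv'
      refine hno ⟨v, fun K hK => ?_⟩
      by_cases h : K = σ X
      · exact hv' K hK fun h' => hXX' (σ.injective (h.symm.trans h'))
      · exact hv K hK h
    · intro X hX u v hv hu
      rw [hY] at hv hu
      push Not at hu
      obtain ⟨K, hK, hKX, huK⟩ := hu
      exact ⟨K, hK, hv K hK hKX, huK⟩
    · intro X hX
      simp only [id]
      by_cases h : X = Z
      · subst h
        simp only [σ, Equiv.swap_apply_left]
        exact hlt W hW X hX hWZ.symm
      · by_cases h' : X = W
        · subst h'
          simp only [σ, Equiv.swap_apply_right]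
          exact hlt Z hZ X hX hWZ
        · simp only [σ, Equiv.swap_apply_of_ne_of_ne h h']
          exact (hmax X hX).trans_lt (hlt X hX Z hZ (Ne.symm h))

lemma Insolid.rho_lt_rho_inter {X Z : Finset V} (hX : Insolid tl hd X) (h : (X ∩ Z).Nonempty)
    {w : V} (hw : w ∈ X) (hwZ : w ∉ Z) :
    rho tl hd Finset.univ X < rho tl hd Finset.univ (X ∩ Z) :=
  hX.2 _ h ((Finset.ssubset_iff_of_subset Finset.inter_subset_left).2
    ⟨w, hw, fun h => hwZ (Finset.mem_inter.1 h).2⟩)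

/-- The intersection graph of the in-solid sets has no hole: a closed chain through `R` has a
chord. -/
lemma not_disjoint_of_chain (k : ℕ) : ∀ (p : ℕ → Finset V) (R : Finset V),
    (∀ i ≤ k, Insolid tl hd (p i)) → Insolid tl hd R →
    (∀ i < k, (p i ∩ p (i + 1)).Nonempty) → (R ∩ p 0).Nonempty → (R ∩ p k).Nonempty →
    (∀ i, 0 < i → i < k → Disjoint R (p i)) → ¬ Disjoint (p 0) (p k) := by
  induction k using Nat.strong_induction_on with
  | _ k ih =>
    intro p R hp hR hcons h0 hk hdR hd0
    have hk2 : 2 ≤ k := by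
      by_contra hlt
      obtain rfl | rfl : k = 0 ∨ k = 1 := by omega
      · obtain ⟨v, hv⟩ := (hp 0 le_rfl).1
        exact Finset.disjoint_left.1 hd0 hv hv
      · obtain ⟨v, hv⟩ := hcons 0 one_pos
        rw [Finset.mem_inter] at hv
        exact Finset.disjoint_left.1 hd0 hv.1 hv.2
    have hfar : ∀ i j, i + 1 < j → j ≤ k → Disjoint (p i) (p j) := by
      intro i j hij hjk
      by_contra hnd
      rw [Finset.not_disjoint_iff_nonempty_inter] at hnd
      have hne : ¬ (i = 0 ∧ j = k) := by
        rintro ⟨rfl, rfl⟩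
        exact Finset.not_disjoint_iff_nonempty_inter.2 hnd hd0
      let d := j - i - 1
      have hd : i + d + 1 = j := by omega
      refine ih (k - d) (by omega) (fun m => if m ≤ i then p m else p (m + d)) R
        ?_ hR ?_ ?_ ?_ ?_ ?_
      · intro m hm
        split_ifs
        · exact hp _ (by omega)
        · exact hp _ (by omega)
      · intro m hm
        rcases lt_trichotomy m i with h | rfl | h
        · rw [if_pos (by omega), if_pos (by omega)]
          exact hcons m (by omega)
        · rw [if_pos le_rfl, if_neg (by omega), show m + 1 + d = j by omega]
          exact hnd
        · rw [if_neg (by omega), if_neg (by omega), show m + 1 + d = m + d + 1 by omega]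
          exact hcons _ (by omega)
      · simpa using h0
      · rw [if_neg (by omega), Nat.sub_add_cancel (by omega)]
        exact hk
      · intro m hm0 hm
        split_ifs
        · exact hdR _ hm0 (by omega)
        · exact hdR _ (by omega) (by omega)
      · rw [if_pos (Nat.zero_le _), if_neg (by omega), Nat.sub_add_cancel (by omega)]
        exact hd0
    let q : ℕ → Finset V := fun i => if i ≤ k then p i else R
    let Y : ℕ → Finset V := fun i => q i ∩ (if i = k + 1 then p 0 else q (i + 1))
    have hq : ∀ i ≤ k, q i = p i := fun i hi => if_pos hi
    have hqR : q (k + 1) = R := if_neg (by omega)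
    have hYlt : ∀ i < k, Y i = p i ∩ p (i + 1) := by
      intro i hi
      simp only [Y]
      rw [if_neg (by omega), hq i (by omega), hq (i + 1) (by omega)]
    have hYk : Y k = p k ∩ R := by
      simp only [Y]
      rw [if_neg (by omega), hq k le_rfl, hqR]
    have hYk1 : Y (k + 1) = R ∩ p 0 := by
      simp only [Y]
      rw [if_pos trivial, hqR]
    have hdY : ∀ i j, i < j → j ≤ k + 1 → Disjoint (Y i) (Y j) := by
      intro i j hij hj
      rw [Finset.disjoint_left]
      intro v hvi hvj
      rcases lt_trichotomy j k with h | rfl | h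
      · rw [hYlt i (by omega), Finset.mem_inter] at hvi
        rw [hYlt j h, Finset.mem_inter] at hvj
        exact Finset.disjoint_left.1 (hfar i (j + 1) (by omega) (by omega)) hvi.1 hvj.2
      · rw [hYlt i hij, Finset.mem_inter] at hvi
        rw [hYk, Finset.mem_inter] at hvj
        rcases Nat.eq_zero_or_pos i with rfl | hi
        · exact Finset.disjoint_left.1 hd0 hvi.1 hvj.1
        · exact Finset.disjoint_left.1 (hdR i hi hij) hvj.2 hvi.1
      · obtain rfl : j = k + 1 := by omega
        rw [hYk1, Finset.mem_inter] at hvj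
        rcases lt_or_eq_of_le (show i ≤ k by omega) with hi | rfl
        · rw [hYlt i hi, Finset.mem_inter] at hvi
          rcases Nat.eq_zero_or_pos i with rfl | hi'
          · exact Finset.disjoint_left.1 (hdR 1 one_pos (by omega)) hvj.1 hvi.2
          · exact Finset.disjoint_left.1 (hdR i hi' hi) hvj.1 hvi.1
        · rw [hYk, Finset.mem_inter] at hvi
          exact Finset.disjoint_left.1 hd0 hvj.2 hvi.1
    refine absurd (sum_rho_le_sum_rho (tl := tl) (hd := hd) (Finset.range (k + 2)) q Y ?_ ?_)
      (not_le.2 (Finset.sum_lt_sum_of_nonempty ⟨0, by simp⟩ ?_))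
    · intro i hi j hj hij
      rw [Finset.mem_range] at hi hj
      rcases lt_or_gt_of_ne hij with h | h
      · exact hdY i j h (by omega)
      · exact (hdY j i h (by omega)).symm
    · intro i hi u v hv hu
      rw [Finset.mem_range] at hi
      obtain ⟨j, hj, hYj⟩ : ∃ j ∈ Finset.range (k + 2), Y i = q i ∩ q j := by
        by_cases h : i = k + 1
        · exact ⟨0, by simp, by simp only [Y]; rw [if_pos h, hq 0 (Nat.zero_le _)]⟩
        · exact ⟨i + 1, Finset.mem_range.2 (by omega), by simp only [Y]; rw [if_neg h]⟩
      rw [hYj, Finset.mem_inter] at hv hu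
      by_cases hui : u ∈ q i
      · exact ⟨j, hj, hv.2, fun h => hu ⟨hui, h⟩⟩
      · exact ⟨i, Finset.mem_range.2 hi, hv.1, hui⟩
    · intro i hi
      rw [Finset.mem_range] at hi
      rcases lt_trichotomy i k with h | rfl | h
      · rw [hq i h.le, hYlt i h]
        rcases Nat.eq_zero_or_pos i with rfl | hi'
        · obtain ⟨v, hv⟩ := h0
          rw [Finset.mem_inter] at hv
          exact (hp 0 h.le).rho_lt_rho_inter (hcons 0 h) hv.2
            (Finset.disjoint_left.1 (hdR 1 one_pos (by omega)) hv.1)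
        · obtain ⟨v, hv⟩ := hcons (i - 1) (by omega)
          rw [Finset.mem_inter, Nat.sub_add_cancel hi'] at hv
          exact (hp i h.le).rho_lt_rho_inter (hcons i h) hv.2
            (Finset.disjoint_left.1 (hfar (i - 1) (i + 1) (by omega) h) hv.1)
      · rw [hq i le_rfl, hYk]
        obtain ⟨v, hv⟩ := hcons (i - 1) (by omega)
        rw [Finset.mem_inter, Nat.sub_add_cancel (by omega)] at hv
        exact (hp i le_rfl).rho_lt_rho_inter (Finset.inter_comm R _ ▸ hk) hv.2
          (Finset.disjoint_right.1 (hdR (i - 1) (by omega) (by omega)) hv.1)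
      · obtain rfl : i = k + 1 := by omega
        rw [hqR, hYk1]
        obtain ⟨v, hv⟩ := hk
        rw [Finset.mem_inter] at hv
        exact hR.rho_lt_rho_inter h0 hv.1 (Finset.disjoint_right.1 hd0 hv.2)

/-- If `r b … b' r` is a closed chain of intersecting in-solid sets whose part strictly between
`b` and `b'` avoids `r`, then `b` and `b'` intersect. -/
lemma inter_nonempty_of_reflTransGen (r b b' c c' : {X : Finset V // Insolid tl hd X})
    (hrb : (r.1 ∩ b.1).Nonempty) (hrb' : (r.1 ∩ b'.1).Nonempty) (hbc : (b.1 ∩ c.1).Nonempty)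
    (hbc' : (b'.1 ∩ c'.1).Nonempty) (hrc : ¬ (r.1 ∩ c.1).Nonempty)
    (h : Relation.ReflTransGen (fun x y : {X : Finset V // Insolid tl hd X} =>
      (x.1 ∩ y.1).Nonempty ∧ ¬ (r.1 ∩ y.1).Nonempty) c c') :
    (b.1 ∩ b'.1).Nonempty := by
  obtain ⟨k, p, rfl, rfl, hp⟩ := exists_seq_of_reflTransGen h
  rw [← Finset.not_disjoint_iff_nonempty_inter]
  have hpr : ∀ i ≤ k, Disjoint r.1 (p i).1 := by
    intro i hi
    rw [Finset.disjoint_iff_inter_eq_empty, ← Finset.not_nonempty_iff_eq_empty]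
    rcases i with _ | i
    · exact hrc
    · exact (hp i hi).2
  let P : ℕ → {X : Finset V // Insolid tl hd X} := fun i =>
    if i = 0 then b else if i ≤ k + 1 then p (i - 1) else b'
  have hP0 : P 0 = b := if_pos rfl
  have hPi : ∀ i ≤ k, P (i + 1) = p i := fun i hi => by
    simp only [P]
    rw [if_neg (by omega), if_pos (by omega), Nat.add_sub_cancel]
  have hPk : P (k + 2) = b' := by
    simp only [P]
    rw [if_neg (by omega), if_neg (by omega)]
  have key := not_disjoint_of_chain (tl := tl) (hd := hd) (k + 2) (fun i => (P i).1) r.1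
    (fun i _ => (P i).2) r.2 ?_ (by rwa [hP0]) (by rwa [hPk]) ?_
  · rwa [hP0, hPk] at key
  · rintro (_ | i) hi
    · rw [hP0, hPi 0 (Nat.zero_le _)]
      exact hbc
    · rcases lt_or_eq_of_le (show i ≤ k by omega) with h | rfl
      · rw [hPi i h.le, hPi (i + 1) h]
        exact (hp i h).1
      · rw [hPi i le_rfl, hPk, Finset.inter_comm]
        exact hbc'
  · rintro (_ | i) hi0 hi
    · omega
    · rw [hPi i (by omega)]
      exact hpr i (by omega)

/-- Given a retraction `r` onto `S` preserving every in-solid set with at least two elements in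
`S`, some `u ∈ S` is dominated within these sets by another `v ∈ S`. -/
lemma exists_dominated [Fintype V] (S : Finset V) (hS : 1 < S.card) (r : V → V)
    (hrS : ∀ v, r v ∈ S)
    (hr : ∀ X, Insolid tl hd X → 1 < (X ∩ S).card → ∀ v ∈ X, r v ∈ X) :
    ∃ u ∈ S, ∃ v ∈ S, u ≠ v ∧ ∀ X, Insolid tl hd X → 1 < (X ∩ S).card → u ∈ X → v ∈ X := by
  classical
  let G : Finset {X : Finset V // Insolid tl hd X} :=
    Finset.univ.filter fun X => 1 < (X.1 ∩ S).card
  by_cases hG : G.Nonempty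
  · obtain ⟨Z, hZ, hsimp⟩ := exists_simplicial
      (M := fun X Y : {X : Finset V // Insolid tl hd X} => (X.1 ∩ Y.1).Nonempty)
      (fun X => by simpa using X.2.1) (fun X Y h => by rwa [Finset.inter_comm])
      inter_nonempty_of_reflTransGen G hG
    have hZS : 1 < (Z.1 ∩ S).card := (Finset.mem_filter.1 hZ).2
    let N := Finset.univ.filter fun X : Finset V =>
      Insolid tl hd X ∧ 1 < (X ∩ S).card ∧ (Z.1 ∩ X).Nonempty
    have hZN : Z.1 ∈ N := by
      simpa [N] using ⟨Z.2, hZS, Z.2.1⟩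
    obtain ⟨w, hw⟩ := exists_mem_of_pairwise_inter (tl := tl) (hd := hd) N ⟨_, hZN⟩
      (fun X hX => (Finset.mem_filter.1 hX).2.1) (fun X hX Y hY => by
        obtain ⟨_, hXi, hXS, hXZ⟩ := Finset.mem_filter.1 hX
        obtain ⟨_, hYi, hYS, hYZ⟩ := Finset.mem_filter.1 hY
        exact hsimp ⟨X, hXi⟩ (Finset.mem_filter.2 ⟨Finset.mem_univ _, hXS⟩)
          ⟨Y, hYi⟩ (Finset.mem_filter.2 ⟨Finset.mem_univ _, hYS⟩) hXZ hYZ)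
    obtain ⟨u, hu, huv⟩ := Finset.exists_mem_ne hZS (r w)
    rw [Finset.mem_inter] at hu
    refine ⟨u, hu.2, r w, hrS w, huv, fun X hX hXS huX => hr X hX hXS w (hw X ?_)⟩
    exact Finset.mem_filter.2 ⟨Finset.mem_univ _, hX, hXS, u, Finset.mem_inter.2 ⟨hu.1, huX⟩⟩
  · obtain ⟨u, hu, v, hv, huv⟩ := Finset.one_lt_card.1 hS
    refine ⟨u, hu, v, hv, huv, fun X hX hXS _ => (hG ⟨⟨X, hX⟩, ?_⟩).elim⟩
    exact Finset.mem_filter.2 ⟨Finset.mem_univ _, hXS⟩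

lemma exists_acyclic_of_retraction [Fintype V] (n : ℕ) : ∀ (S : Finset V), S.card = n + 1 →
    ∀ r : V → V, (∀ v, r v ∈ S) →
    (∀ X, Insolid tl hd X → 1 < (X ∩ S).card → ∀ v ∈ X, r v ∈ X) →
    ∃ T : SimpleGraph V, T.IsAcyclic ∧ (∀ a b, T.Adj a b → a ∈ S ∧ b ∈ S) ∧
      ∀ X, (X = Finset.univ ∨ Insolid tl hd X) →
        (T.induce ((X ∩ S : Finset V) : Set V)).Preconnected := by
  induction n with
  | zero =>
    intro S hS r _ _
    refine ⟨⊥, SimpleGraph.isAcyclic_bot, by simp, fun X _ a b => ?_⟩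
    have hab : a = b := Subtype.ext (Finset.card_le_one.1 hS.le _ (Finset.mem_inter.1 a.2).2 _
      (Finset.mem_inter.1 b.2).2)
    exact hab ▸ SimpleGraph.Reachable.refl _
  | succ n ih =>
    intro S hS r hrS hr
    obtain ⟨u, hu, v, hv, huv, hdom⟩ := exists_dominated S (by omega) r hrS hr
    have hvS' : v ∈ S.erase u := Finset.mem_erase.2 ⟨huv.symm, hv⟩
    obtain ⟨T, hT, hTS, hTX⟩ := ih (S.erase u) (by rw [Finset.card_erase_of_mem hu, hS]; rfl)
      (fun w => if r w = u then v else r w)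
      (fun w => by
        split_ifs with h
        · exact hvS'
        · exact Finset.mem_erase.2 ⟨h, hrS w⟩)
      (fun X hX hXS w hw => by
        have hXS' : 1 < (X ∩ S).card := hXS.trans_le
          (Finset.card_le_card (Finset.inter_subset_inter_left (Finset.erase_subset _ _)))
        have hrw := hr X hX hXS' w hw
        split_ifs with h
        · exact hdom X hX hXS' (h ▸ hrw)
        · exact hrw)
    have hnr : ¬ T.Reachable u v := by
      rintro ⟨p⟩
      cases p with
      | nil => exact huv rfl
      | cons h _ => exact (Finset.mem_erase.1 (hTS _ _ h).1).1 rfl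
    have hadj : (T ⊔ SimpleGraph.edge u v).Adj u v :=
      Or.inr ((SimpleGraph.edge_adj _ _ _ _).2 ⟨Or.inl ⟨rfl, rfl⟩, huv⟩)
    refine ⟨T ⊔ SimpleGraph.edge u v, hT.sup_edge_of_not_reachable hnr, ?_, fun X hX => ?_⟩
    · rintro a b (h | h)
      · exact ⟨Finset.mem_of_mem_erase (hTS a b h).1, Finset.mem_of_mem_erase (hTS a b h).2⟩
      · rw [SimpleGraph.edge_adj] at h
        rcases h.1 with ⟨rfl, rfl⟩ | ⟨rfl, rfl⟩
        · exact ⟨hu, hv⟩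
        · exact ⟨hv, hu⟩
    · have hpre : ((T ⊔ SimpleGraph.edge u v).induce
          ((X ∩ S.erase u : Finset V) : Set V)).Preconnected :=
        (hTX X hX).mono fun a b h => Or.inl h
      by_cases huX : u ∈ X
      · by_cases hvX : v ∈ X
        · have hset : ((X ∩ S : Finset V) : Set V) =
              ((X ∩ S.erase u : Finset V) : Set V) ∪ {u, v} := by
            ext w
            simp only [Finset.coe_inter, Finset.coe_erase, Set.mem_inter_iff, Set.mem_union,
              Set.mem_sdiff, Set.mem_insert_iff, Set.mem_singleton_iff, Finset.mem_coe]
            grind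
          rw [hset]
          exact (SimpleGraph.induce_union_connected hpre
            (SimpleGraph.induce_pair_connected_of_adj hadj).preconnected
            ⟨v, by simp [hvX, hv, huv.symm]⟩).preconnected
        · have hcard : (X ∩ S).card ≤ 1 := by
            rcases hX with rfl | hX
            · exact absurd (Finset.mem_univ v) hvX
            · exact not_lt.1 fun h => hvX (hdom X hX h huX)
          intro a b
          have hab : a = b := Subtype.ext (Finset.card_le_one.1 hcard _ a.2 _ b.2)
          exact hab ▸ SimpleGraph.Reachable.refl _
      · have hset : X ∩ S = X ∩ S.erase u := by
          ext w
          simp only [Finset.mem_inter, Finset.mem_erase]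
          grind
        rw [hset]
        exact hpre

end Insolid

/-- **Bárász–Becker–Frank subtree representation.**  The family of in-solid sets
of a finite directed multigraph is a subtree hypergraph: there is a spanning
tree `T` on the vertex set such that every in-solid set induces a connected
subgraph (subtree) of `T`. -/
theorem insolid_family_subtree_hypergraph
    {V A : Type*} [Fintype V] [DecidableEq V] [Nonempty V]
    [Fintype A] [DecidableEq A] (tl hd : A → V) :
    ∃ T : SimpleGraph V, T.IsTree ∧
      ∀ X : Finset V, Insolid tl hd X → (T.induce (X : Set V)).Connected := by
  obtain ⟨T, hT, -, hTX⟩ := exists_acyclic_of_retraction (tl := tl) (hd := hd)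
    (Fintype.card V - 1) Finset.univ
    (by rw [Finset.card_univ, Nat.sub_add_cancel Fintype.card_pos])
    id (fun _ => Finset.mem_univ _) (fun _ _ _ _ h => h)
  have hTX' : ∀ X, (X = Finset.univ ∨ Insolid tl hd X) →
      (T.induce (X : Set V)).Preconnected := fun X hX => by
    have h := hTX X hX
    rwa [Finset.inter_univ] at h
  refine ⟨T, ⟨⟨?_⟩, hT⟩, fun X hX => ?_⟩
  · have h := hTX' _ (Or.inl rfl)
    rw [Finset.coe_univ] at h
    exact (SimpleGraph.induceUnivIso T).preconnected_iff.1 h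
  · have : Nonempty (X : Set V) := hX.1.to_subtype
    exact ⟨hTX' X (Or.inr hX)⟩
end

section
/- Helly property of insolid sets: Let D = (V, A) be a finite directed multigraph and let 𝒮 be a finite non-empty family of insolid sets of D that pairwise intersect (X ∩ Y ≠ ∅ for all X, Y ∈ 𝒮). Then all members of 𝒮 have a common vertex: ∩_{X∈𝒮} X ≠ ∅. -/
/-- The vertices lying in every member of `S` other than `X`. -/
def interOthers {V : Type*} [Fintype V] [DecidableEq V]
    (S : Finset (Finset V)) (X : Finset V) : Finset V :=
  Finset.univ.filter fun v => ∀ Y ∈ S, Y ≠ X → v ∈ Y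

lemma mem_interOthers {V : Type*} [Fintype V] [DecidableEq V]
    {S : Finset (Finset V)} {X : Finset V} {v : V} :
    v ∈ interOthers S X ↔ ∀ Y ∈ S, Y ≠ X → v ∈ Y := by
  simp [interOthers]

/-- If `S` has no common vertex, the in-degrees of the sets `interOthers S X` sum to at most
the sum of the in-degrees of the members of `S`. -/
lemma sum_rho_interOthers_le {V A : Type*} [Fintype V] [DecidableEq V] [Fintype A]
    [DecidableEq A] (tl hd : A → V) (B : Finset A) (S : Finset (Finset V))
    (hS : ¬ ∃ v, ∀ X ∈ S, v ∈ X) :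
    ∑ X ∈ S, rho tl hd B (interOthers S X) ≤ ∑ X ∈ S, rho tl hd B X := by
  unfold rho
  rw [← Finset.card_biUnion]
  · refine le_trans (Finset.card_le_card fun a ha => ?_) Finset.card_biUnion_le
    simp only [Finset.mem_biUnion, Finset.mem_filter, mem_interOthers] at ha ⊢
    obtain ⟨X, hX, haB, htl, hhd⟩ := ha
    push Not at htl
    obtain ⟨Y, hY, hYX, htY⟩ := htl
    exact ⟨Y, hY, haB, htY, hhd Y hY hYX⟩
  · intro X hX Y hY hXY
    refine Finset.disjoint_left.2 fun a haX haY => hS ⟨hd a, fun W hW => ?_⟩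
    simp only [Finset.mem_filter, mem_interOthers] at haX haY
    by_cases h : W = X
    · exact haY.2.2 W hW (h ▸ hXY)
    · exact haX.2.2 W hW h

/-- A family of at least three in-solid sets, all of whose subfamilies omitting one member have
a common vertex, has a common vertex. -/
lemma exists_common_vertex_of_erase {V A : Type*} [Fintype V] [DecidableEq V] [Fintype A]
    [DecidableEq A] (tl hd : A → V) (S : Finset (Finset V)) (hcard : 2 < S.card)
    (hins : ∀ X ∈ S, Insolid tl hd X)
    (herase : ∀ X ∈ S, ∃ v, ∀ Y ∈ S.erase X, v ∈ Y) :
    ∃ v, ∀ X ∈ S, v ∈ X := by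
  by_contra hS
  have hnonempty : ∀ X ∈ S, (interOthers S X).Nonempty := fun X hX => by
    obtain ⟨v, hv⟩ := herase X hX
    exact ⟨v, mem_interOthers.2 fun Y hY hYX => hv Y (Finset.mem_erase.2 ⟨hYX, hY⟩)⟩
  have hlt : ∀ X ∈ S, ∀ Y ∈ S.erase X,
      rho tl hd Finset.univ Y < rho tl hd Finset.univ (interOthers S X) := by
    intro X hX Y hY
    obtain ⟨hYX, hY⟩ := Finset.mem_erase.1 hY
    refine (hins Y hY).2 _ (hnonempty X hX) ⟨fun v hv => mem_interOthers.1 hv Y hY hYX, ?_⟩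
    intro hsub
    obtain ⟨W, hW, hWX, hWY⟩ : ∃ W ∈ S, W ≠ X ∧ W ≠ Y := by
      by_contra! h
      have : S ⊆ {X, Y} := fun W hW => by
        by_cases hWX : W = X
        · simp [hWX]
        · simp [h W hW hWX]
      exact absurd (Finset.card_le_card this) (by
        have := Finset.card_le_two (a := X) (b := Y)
        omega)
    obtain ⟨v, hv⟩ := hnonempty W hW
    have hv' := mem_interOthers.1 hv
    have hvX := mem_interOthers.1 (hsub (hv' Y hY hWY.symm))
    refine hS ⟨v, fun U hU => ?_⟩
    by_cases h : U = X
    · exact hv' U hU (h ▸ hWX.symm)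
    · exact hvX U hU h
  obtain ⟨X₀, hX₀⟩ : S.Nonempty := Finset.card_pos.1 (by omega)
  have hsum : ∑ X ∈ S, ∑ Y ∈ S.erase X, rho tl hd Finset.univ Y <
      ∑ X ∈ S, ∑ _Y ∈ S.erase X, rho tl hd Finset.univ (interOthers S X) := by
    refine Finset.sum_lt_sum_of_nonempty ⟨X₀, hX₀⟩ fun X hX => ?_
    refine Finset.sum_lt_sum_of_nonempty (Finset.card_pos.1 ?_) (hlt X hX)
    rw [Finset.card_erase_of_mem hX]
    omega
  have hconst : ∀ f : Finset V → ℕ,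
      ∑ X ∈ S, ∑ _Y ∈ S.erase X, f X = (S.card - 1) * ∑ X ∈ S, f X := fun f => by
    rw [Finset.mul_sum]
    refine Finset.sum_congr rfl fun X hX => ?_
    rw [Finset.sum_const, Finset.card_erase_of_mem hX, smul_eq_mul]
  have hswap : ∑ X ∈ S, ∑ Y ∈ S.erase X, rho tl hd Finset.univ Y =
      ∑ Y ∈ S, ∑ _X ∈ S.erase Y, rho tl hd Finset.univ Y :=
    Finset.sum_comm' fun X Y => by simp only [Finset.mem_erase]; tauto
  rw [hswap, hconst, hconst] at hsum
  exact absurd hsum (not_lt.2 (Nat.mul_le_mul_left _ (sum_rho_interOthers_le tl hd _ S hS)))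

/-- **Helly property of in-solid sets.**  If the members of a finite non-empty
family of in-solid sets pairwise intersect, then they have a common vertex. -/
theorem insolid_helly
    {V A : Type*} [Fintype V] [DecidableEq V] [Fintype A] [DecidableEq A]
    (tl hd : A → V) (S : Finset (Finset V)) (hne : S.Nonempty)
    (hins : ∀ X ∈ S, Insolid tl hd X)
    (hpair : ∀ X ∈ S, ∀ Y ∈ S, (X ∩ Y).Nonempty) :
    ∃ v : V, ∀ X ∈ S, v ∈ X := by
  induction S using Finset.strongInduction with
  | H S ih =>
    by_cases hcard : 2 < S.card
    · refine exists_common_vertex_of_erase tl hd S hcard hins fun X hX => ?_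
      refine ih _ (Finset.erase_ssubset hX) (Finset.card_pos.1 ?_)
        (fun Y hY => hins Y (Finset.mem_of_mem_erase hY))
        (fun Y hY Z hZ => hpair Y (Finset.mem_of_mem_erase hY) Z (Finset.mem_of_mem_erase hZ))
      rw [Finset.card_erase_of_mem hX]
      omega
    · obtain ⟨X, Y, hX, hY, hXY⟩ : ∃ X Y, X ∈ S ∧ Y ∈ S ∧ ∀ W ∈ S, W = X ∨ W = Y := by
        have hpos := hne.card_pos
        obtain h | h : S.card = 1 ∨ S.card = 2 := by omega
        · obtain ⟨X, rfl⟩ := Finset.card_eq_one.1 h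
          exact ⟨X, X, by simp⟩
        · obtain ⟨X, Y, -, rfl⟩ := Finset.card_eq_two.1 h
          exact ⟨X, Y, by simp⟩
      obtain ⟨v, hv⟩ := hpair X hX Y hY
      rw [Finset.mem_inter] at hv
      refine ⟨v, fun W hW => ?_⟩
      rcases hXY W hW with rfl | rfl
      exacts [hv.1, hv.2]
end

section
/- Frank's min-max theorem for subtree hypergraphs: Let V′ be a finite set, let ℰ ⊆ 2^{V′} be a subtree hypergraph on V′, and let val : ℰ → ℝ≥0 be a non-negative weight function. Then max{Σ_{e∈ℰ′} val(e) : ℰ′ is a collection of pairwise disjoint members of ℰ} = min{Σ_{v∈V′} y(v) : y : V′ → ℝ, y ≥ 0, Σ_{v∈e} y(v) ≥ val(e) for every e ∈ ℰ}. -/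
/-- A family `E` of finite subsets of `V` is a subtree hypergraph if there is a
tree `T` spanning `V` such that every member of `E` induces a connected
subgraph (subtree) of `T`. -/
def IsSubtreeHypergraph {V : Type*} (E : Finset (Finset V)) : Prop :=
  ∃ T : SimpleGraph V, T.IsTree ∧ ∀ e ∈ E, (T.induce (e : Set V)).Connected

/-- Rooting a tree gives a depth function `d` together with, for every vertex `x` and every
`k ≤ d x`, the ancestor `a x k` of `x` at depth `k`. -/
lemma SimpleGraph.IsTree.exists_depth_ancestor {V : Type*} {T : SimpleGraph V} (hT : T.IsTree) :
    ∃ (d : V → ℕ) (a : V → ℕ → V), (∀ x, a x (d x) = x) ∧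
      (∀ x y, T.Adj x y → d x ≤ d y + 1) ∧
      ∀ x y k, T.Adj x y → k ≤ d x → k ≤ d y → a x k = a y k := by
  obtain ⟨r⟩ := hT.connected.nonempty
  choose p hp _ using fun x => hT.existsUnique_path r x
  have hconcat : ∀ x y (h : T.Adj x y), p y = (p x).concat h ∨ p x = (p y).concat h.symm := by
    intro x y h
    by_cases hx : x ∈ (p y).support
    · exact .inl (hT.isAcyclic.path_concat (hp x) (hp y) h hx)
    · exact .inr (hT.isAcyclic.path_concat (hp y) (hp x) h.symm
        (hT.isAcyclic.mem_support_of_ne_mem_support_of_adj_of_isPath (hp x) (hp y) h hx))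
  refine ⟨fun x => (p x).length, fun x => (p x).getVert, fun x => (p x).getVert_length, ?_, ?_⟩
  · intro x y h
    rcases hconcat x y h with e | e <;> simp only [e, SimpleGraph.Walk.length_concat] <;> omega
  · intro x y k h hx hy
    dsimp only at hx hy ⊢
    rcases hconcat x y h with e | e
    · rw [e, SimpleGraph.Walk.concat_eq_append, SimpleGraph.Walk.getVert_append', if_pos hx]
    · rw [e, SimpleGraph.Walk.concat_eq_append, SimpleGraph.Walk.getVert_append', if_pos hy]

/-- In a subtree hypergraph every hyperedge `e` has a top vertex `t e` such that, of two
intersecting hyperedges, the one whose top is at least as high contains the other's top. -/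
lemma IsSubtreeHypergraph.exists_top {V : Type*} {E : Finset (Finset V)}
    (hE : IsSubtreeHypergraph E) :
    ∃ (t : Finset V → V) (δ : Finset V → ℕ), (∀ e ∈ E, t e ∈ e) ∧
      ∀ e ∈ E, ∀ f ∈ E, δ f ≤ δ e → ¬ Disjoint e f → t e ∈ f := by
  obtain ⟨T, hT, hconn⟩ := hE
  obtain ⟨d, a, ha, hd, hadj⟩ := hT.exists_depth_ancestor
  have hmem : ∀ (s : Set V) (u w : s), (T.induce s).Walk u w → ∀ k, d w ≤ k → k ≤ d u →
      a u k ∈ s := by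
    intro s u w p
    induction p with
    | nil =>
      intro k h₁ h₂
      rw [le_antisymm h₂ h₁, ha]
      exact Subtype.property _
    | @cons u v w h p ih =>
      intro k h₁ h₂
      have h' : T.Adj u v := h
      rcases h₂.eq_or_lt with rfl | h₂
      · rw [ha]
        exact u.2
      · have := hd _ _ h'
        rw [hadj _ _ k h' (by omega) (by omega)]
        exact ih k h₁ (by omega)
  have hconst : ∀ (s : Set V) (u w : s), (T.induce s).Walk u w → ∀ k, (∀ x ∈ s, k ≤ d x) →
      a u k = a w k := by
    intro s u w p k hk
    induction p with
    | nil => rfl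
    | @cons u v w h p ih =>
      rw [← ih]
      exact hadj _ _ k h (hk _ u.2) (hk _ v.2)
  have htop : ∀ e ∈ E, ∃ t ∈ e, ∀ x ∈ e, d t ≤ d x := by
    intro e he
    obtain ⟨x⟩ := (hconn e he).nonempty
    exact e.exists_min_image d ⟨x, x.2⟩
  have : Nonempty V := hT.connected.nonempty
  choose! t ht hmin using htop
  refine ⟨t, fun e => d (t e), ht, ?_⟩
  intro e he f hf hle hdis
  obtain ⟨x, hxe, hxf⟩ := Finset.not_disjoint_iff.1 hdis
  obtain ⟨p⟩ := (hconn e he).preconnected ⟨x, hxe⟩ ⟨t e, ht e he⟩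
  obtain ⟨q⟩ := (hconn f hf).preconnected ⟨x, hxf⟩ ⟨t f, ht f hf⟩
  have h₁ : a x (d (t e)) = t e := (hconst _ _ _ p _ (hmin e he)).trans (ha _)
  rw [← h₁]
  exact hmem _ _ _ q _ hle (hmin e he x hxe)

/-- A hypergraph whose edges have top vertices in the sense of
`IsSubtreeHypergraph.exists_top` admits, for all real weights, a matching and a fractional
cover of equal value. -/
lemma exists_matching_cover_eq {V : Type*} [Fintype V] [DecidableEq V]
    (t : Finset V → V) (δ : Finset V → ℕ) (E : Finset (Finset V)) (ht : ∀ e ∈ E, t e ∈ e)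
    (hδ : ∀ e ∈ E, ∀ f ∈ E, δ f ≤ δ e → ¬ Disjoint e f → t e ∈ f) (val : Finset V → ℝ) :
    ∃ E' ⊆ E, (∀ e ∈ E', ∀ f ∈ E', e ≠ f → Disjoint e f) ∧
      ∃ y : V → ℝ, (∀ v, 0 ≤ y v) ∧ (∀ e ∈ E, val e ≤ ∑ v ∈ e, y v) ∧
        ∑ e ∈ E', val e = ∑ v, y v := by
  induction E using Finset.strongInduction generalizing val with
  | H E ih =>
  rcases E.eq_empty_or_nonempty with rfl | hne
  · exact ⟨∅, subset_rfl, by simp, 0, by simp, by simp, by simp⟩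
  obtain ⟨e, he, hmax⟩ := E.exists_max_image δ hne
  have ih' := ih (E.erase e) (Finset.erase_ssubset he)
    (fun f hf => ht f (Finset.mem_of_mem_erase hf))
    (fun f hf g hg => hδ f (Finset.mem_of_mem_erase hf) g (Finset.mem_of_mem_erase hg))
  rcases le_or_gt (val e) 0 with hv | hv
  · obtain ⟨M, hM, hdis, y, hy, hcov, hsum⟩ := ih' val
    refine ⟨M, hM.trans (Finset.erase_subset _ _), hdis, y, hy, fun f hf => ?_, hsum⟩
    by_cases hfe : f = e
    · subst hfe
      exact hv.trans (Finset.sum_nonneg fun v _ => hy v)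
    · exact hcov f (Finset.mem_erase.2 ⟨hfe, hf⟩)
  · obtain ⟨M, hM, hdis, y, hy, hcov, hsum⟩ :=
      ih' fun f => val f - if t e ∈ f then val e else 0
    have hy' : ∀ s : Finset V, ∑ v ∈ s, (y v + if t e = v then val e else 0) =
        ∑ v ∈ s, y v + if t e ∈ s then val e else 0 := fun s => by
      rw [Finset.sum_add_distrib, Finset.sum_ite_eq]
    have hME : M ⊆ E := hM.trans (Finset.erase_subset _ _)
    have heM : e ∉ M := fun h => Finset.notMem_erase e E (hM h)
    rw [Finset.sum_sub_distrib] at hsum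
    suffices h : ∃ M' ⊆ E, (∀ f ∈ M', ∀ g ∈ M', f ≠ g → Disjoint f g) ∧
        ∑ f ∈ M', val f = ∑ v, y v + val e by
      obtain ⟨M', hM', hdis', hsum'⟩ := h
      refine ⟨M', hM', hdis', fun v => y v + if t e = v then val e else 0, fun v => ?_,
        fun f hf => ?_, ?_⟩
      · have := hy v
        dsimp only
        split_ifs <;> linarith
      · rw [hy']
        by_cases hfe : f = e
        · subst hfe
          rw [if_pos (ht f hf)]
          linarith [Finset.sum_nonneg fun v (_ : v ∈ f) => hy v]
        · linarith [hcov f (Finset.mem_erase.2 ⟨hfe, hf⟩)]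
      · rw [hy', if_pos (Finset.mem_univ _), hsum']
    by_cases hex : ∃ g ∈ M, t e ∈ g
    · obtain ⟨g, hg, htg⟩ := hex
      refine ⟨M, hME, hdis, ?_⟩
      rw [Finset.sum_eq_single_of_mem g hg fun f hf hfg => if_neg fun htf =>
        Finset.disjoint_left.1 (hdis f hf g hg hfg) htf htg, if_pos htg] at hsum
      linarith
    · push Not at hex
      have hdise : ∀ f ∈ M, Disjoint e f := fun f hf => by
        by_contra h
        exact hex f hf (hδ e he f (hME hf) (hmax f (hME hf)) h)
      refine ⟨insert e M, Finset.insert_subset he hME, ?_, ?_⟩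
      · intro f hf g hg hfg
        rcases Finset.mem_insert.1 hf with rfl | hf' <;>
          rcases Finset.mem_insert.1 hg with rfl | hg'
        · exact absurd rfl hfg
        · exact hdise g hg'
        · exact (hdise f hf').symm
        · exact hdis f hf' g hg' hfg
      · rw [Finset.sum_eq_zero fun f hf => if_neg (hex f hf)] at hsum
        rw [Finset.sum_insert heM]
        linarith

/-- Weak duality: the weight of a matching is at most the value of a fractional cover. -/
lemma sum_matching_le_sum_cover {V : Type*} [Fintype V] [DecidableEq V]
    {M : Finset (Finset V)} {val : Finset V → ℝ} {y : V → ℝ}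
    (hM : ∀ e ∈ M, ∀ f ∈ M, e ≠ f → Disjoint e f) (hy : ∀ v, 0 ≤ y v)
    (hcov : ∀ e ∈ M, val e ≤ ∑ v ∈ e, y v) : ∑ e ∈ M, val e ≤ ∑ v, y v :=
  calc ∑ e ∈ M, val e ≤ ∑ e ∈ M, ∑ v ∈ e, y v := Finset.sum_le_sum hcov
    _ = ∑ v ∈ M.biUnion id, y v :=
      (Finset.sum_biUnion fun e he f hf hef => hM e he f hf hef).symm
    _ ≤ ∑ v, y v := Finset.sum_le_univ_sum_of_nonneg hy

/-- **Frank's min-max theorem for subtree hypergraphs.**  For a subtree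
hypergraph `E` on a finite set with non-negative weights `val`, the maximum
weight of a collection of pairwise disjoint hyperedges equals the minimum of
`∑_v y(v)` over all non-negative fractional covers `y`. -/
theorem frank_subtree_hypergraph_minmax
    {V : Type*} [Fintype V] [DecidableEq V]
    (E : Finset (Finset V)) (hE : IsSubtreeHypergraph E)
    (val : Finset V → ℝ) (hval : ∀ e ∈ E, 0 ≤ val e) :
    ∃ m : ℝ,
      IsGreatest {x : ℝ | ∃ E' : Finset (Finset V), E' ⊆ E ∧
          (∀ e ∈ E', ∀ f ∈ E', e ≠ f → Disjoint e f) ∧ x = ∑ e ∈ E', val e} m ∧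
      IsLeast {x : ℝ | ∃ y : V → ℝ, (∀ v, 0 ≤ y v) ∧
          (∀ e ∈ E, val e ≤ ∑ v ∈ e, y v) ∧ x = ∑ v, y v} m := by
  obtain ⟨t, δ, ht, hδ⟩ := hE.exists_top
  obtain ⟨M, hME, hdis, y, hy, hcov, hsum⟩ := exists_matching_cover_eq t δ E ht hδ val
  refine ⟨∑ e ∈ M, val e, ⟨⟨M, hME, hdis, rfl⟩, ?_⟩, ⟨⟨y, hy, hcov, hsum⟩, ?_⟩⟩
  · rintro _ ⟨N, hNE, hN, rfl⟩
    rw [hsum]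
    exact sum_matching_le_sum_cover hN hy fun e he => hcov e (hNE he)
  · rintro _ ⟨z, hz, hzcov, rfl⟩
    exact sum_matching_le_sum_cover hdis hz fun e he => hzcov e (hME he)
end

section
/- Integrality of the fractional cover for subtree hypergraphs: Let V′ be a finite set, let ℰ ⊆ 2^{V′} be a subtree hypergraph on V′, and let val : ℰ → ℤ≥0 be a non-negative integer weight function. Then the minimum min{Σ_{v∈V′} y(v) : y : V′ → ℝ, y ≥ 0, Σ_{v∈e} y(v) ≥ val(e) for every e ∈ ℰ} is attained by a non-negative integer-valued function y : V′ → ℤ≥0. -/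
namespace SimpleGraph

variable {V : Type*} {T : SimpleGraph V}

/-- In a tree, a vertex has at most one neighbour closer to the root. -/
lemma IsTree.eq_of_adj_of_dist_add_one (hT : T.IsTree) (r : V) {v a b : V}
    (ha : T.Adj a v) (hb : T.Adj b v)
    (hda : T.dist r v = T.dist r a + 1) (hdb : T.dist r v = T.dist r b + 1) : a = b := by
  obtain ⟨p, -, hp⟩ := hT.connected.exists_path_of_dist r a
  obtain ⟨q, -, hq⟩ := hT.connected.exists_path_of_dist r b
  have hpc := (p.concat ha).isPath_of_length_eq_dist (by simp [hp, hda])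
  have hqc := (q.concat hb).isPath_of_length_eq_dist (by simp [hq, hdb])
  have h := (hT.existsUnique_path r v).unique hpc hqc
  simpa using congrArg Walk.penultimate h

/-- In a tree, a path that starts by moving away from the root keeps moving away from it. -/
lemma IsTree.dist_lt_of_isPath (hT : T.IsTree) (r : V) {w u : V} (q : T.Walk w u) :
    ∀ {v : V}, T.Adj v w → T.dist r w = T.dist r v + 1 → q.IsPath → v ∉ q.support →
      T.dist r v < T.dist r u := by
  induction q with
  | nil => intro v _ h _ _; omega
  | @cons w x u hwx q ih =>
    intro v hvw hd hq hv
    rw [Walk.cons_isPath_iff] at hq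
    rcases hT.dist_eq_dist_add_one_of_adj r hwx with h | h
    · have hvx := hT.eq_of_adj_of_dist_add_one r hvw hwx.symm hd h
      subst hvx
      simp at hv
    · have := ih hwx h hq.1 hq.2
      omega

/-- In a rooted tree there is a parent map such that each subtree contains the parent of each of
its vertices that is not the unique vertex of the subtree closest to the root. -/
lemma IsTree.exists_parent (hT : T.IsTree) (r : V) :
    ∃ p : V → V, ∀ s : Set V, (T.induce s).Connected → ∀ v ∈ s, ∀ u ∈ s, u ≠ v →
      T.dist r u ≤ T.dist r v → p v ∈ s ∧ T.dist r (p v) < T.dist r v := by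
  classical
  have hex : ∀ v, ∃ x, ∀ w, T.Adj w v → T.dist r v = T.dist r w + 1 → w = x := by
    intro v
    by_cases h : ∃ w, T.Adj w v ∧ T.dist r v = T.dist r w + 1
    · obtain ⟨x, hx, hdx⟩ := h
      exact ⟨x, fun w hw hdw => hT.eq_of_adj_of_dist_add_one r hw hx hdw hdx⟩
    · exact ⟨v, fun w hw hdw => (h ⟨w, hw, hdw⟩).elim⟩
  choose p hp using hex
  refine ⟨p, fun s hs v hv u hu huv hd => ?_⟩
  obtain ⟨q, hq⟩ := (hs.preconnected ⟨v, hv⟩ ⟨u, hu⟩).exists_isPath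
  cases q with
  | nil => exact (huv rfl).elim
  | @cons _ w _ hvw q =>
    have hadj : T.Adj v w := hvw
    rcases hT.dist_eq_dist_add_one_of_adj r hadj with h | h
    · rw [← hp v w hadj.symm h]
      exact ⟨w.2, by omega⟩
    · have hmap := hq.map (f := (Embedding.induce (G := T) s).toHom) Subtype.val_injective
      rw [Walk.map_cons, Walk.cons_isPath_iff] at hmap
      have := hT.dist_lt_of_isPath r _ hadj h hmap.1 hmap.2
      exact absurd hd (not_le.mpr this)

end SimpleGraph

/-- A finite family of weighted nonempty sets, closed under a parent map except at their unique
vertices of minimal depth, has an integral cover that is optimal among fractional covers. -/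
lemma exists_nat_cover_of_parent {V ι : Type*} [DecidableEq V] (d : V → ℕ) (p : V → V)
    (S : Finset V) :
    ∀ (I : Finset ι) (e : ι → Finset V) (w : ι → ℕ),
      (∀ i ∈ I, (e i).Nonempty ∧ e i ⊆ S ∧ ∀ v ∈ e i, ∀ u ∈ e i, u ≠ v → d u ≤ d v →
        p v ∈ e i ∧ d (p v) < d v) →
      ∃ y : V → ℕ, (∀ i ∈ I, w i ≤ ∑ v ∈ e i, y v) ∧
        ∀ z : V → ℝ, (∀ v, 0 ≤ z v) → (∀ i ∈ I, (w i : ℝ) ≤ ∑ v ∈ e i, z v) →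
          ∑ v ∈ S, (y v : ℝ) ≤ ∑ v ∈ S, z v := by
  induction S using Finset.induction_on_max_value d with
  | empty =>
    intro I e w h
    refine ⟨0, fun i hi => ?_, by simp⟩
    obtain ⟨⟨x, hx⟩, hS, -⟩ := h i hi
    exact absurd (hS hx) (by simp)
  | insert v S hv hmax ih =>
    intro I e w h
    set a : ℕ := (I.filter fun i => e i = {v}).sup w
    obtain ⟨y, hy, hopt⟩ := ih (I.filter fun i => ((e i).erase v).Nonempty)
      (fun i => (e i).erase v) (fun i => if v ∈ e i then w i - a else w i) (by
        intro i hi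
        rw [Finset.mem_filter] at hi
        obtain ⟨-, hS, hpar⟩ := h i hi.1
        refine ⟨hi.2, fun x hx => ?_, fun x hx u hu hux hd => ?_⟩
        · rw [Finset.mem_erase] at hx
          exact Finset.mem_of_mem_insert_of_ne (hS hx.2) hx.1
        · rw [Finset.mem_erase] at hx hu
          obtain ⟨h1, h2⟩ := hpar x hx.2 u hu.2 hux hd
          refine ⟨Finset.mem_erase.mpr ⟨?_, h1⟩, h2⟩
          intro hpx
          have := hmax x (Finset.mem_of_mem_insert_of_ne (hS hx.2) hx.1)
          rw [hpx] at h2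
          omega)
    have hsum : ∀ s : Finset V, v ∉ s →
        ∑ x ∈ s, Function.update y v a x = ∑ x ∈ s, y x := fun s hs =>
      Finset.sum_congr rfl fun x hx => Function.update_of_ne (ne_of_mem_of_not_mem hx hs) _ _
    refine ⟨Function.update y v a, fun i hi => ?_, fun z hz hcov => ?_⟩
    · by_cases hne : ((e i).erase v).Nonempty
      · have hyi := hy i (Finset.mem_filter.mpr ⟨hi, hne⟩)
        by_cases hvi : v ∈ e i
        · rw [← Finset.add_sum_erase _ _ hvi, hsum _ (Finset.notMem_erase v _)]
          simp only [hvi, if_true] at hyi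
          simp only [Function.update_self]
          omega
        · rw [hsum _ hvi]
          simpa [hvi] using hyi
      · have hev : e i = {v} := by
          rw [Finset.not_nonempty_iff_eq_empty, Finset.erase_eq_empty_iff] at hne
          exact hne.resolve_left (h i hi).1.ne_empty
        rw [hev, Finset.sum_singleton, Function.update_self]
        exact Finset.le_sup (f := w) (Finset.mem_filter.mpr ⟨hi, hev⟩)
    · have haz : (a : ℝ) ≤ z v := by
        refine (Nat.le_floor_iff (hz v)).mp (Finset.sup_le fun i hi => ?_)
        rw [Finset.mem_filter] at hi
        exact Nat.le_floor (by simpa [hi.2] using hcov i hi.1)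
      have hz' : ∀ x, 0 ≤ if x = p v then z v - a else 0 := fun x => by
        split_ifs <;> linarith
      have key := hopt (fun x => z x + if x = p v then z v - a else 0)
        (fun x => add_nonneg (hz x) (hz' x)) (by
          intro i hi
          rw [Finset.mem_filter] at hi
          have hci := hcov i hi.1
          obtain ⟨-, hS, hpar⟩ := h i hi.1
          rw [Finset.sum_add_distrib]
          by_cases hvi : v ∈ e i
          · obtain ⟨u, hu⟩ := hi.2
            rw [Finset.mem_erase] at hu
            have hdu := hmax u (Finset.mem_of_mem_insert_of_ne (hS hu.2) hu.1)
            obtain ⟨h1, h2⟩ := hpar v hvi u hu.2 hu.1 hdu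
            have hpv : p v ≠ v := fun hpv => by rw [hpv] at h2; omega
            rw [← Finset.add_sum_erase _ _ hvi] at hci
            rw [Finset.sum_ite_eq', if_pos (Finset.mem_erase.mpr ⟨hpv, h1⟩), if_pos hvi]
            have hpos : 0 ≤ ∑ x ∈ (e i).erase v, z x := Finset.sum_nonneg fun x _ => hz x
            rcases le_total a (w i) with haw | haw
            · rw [Nat.cast_sub haw]
              linarith
            · rw [Nat.sub_eq_zero_of_le haw]
              push_cast
              linarith
          · have hpos := Finset.sum_nonneg fun x (_ : x ∈ e i) => hz' x
            rw [if_neg hvi, Finset.erase_eq_of_notMem hvi]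
            linarith)
      rw [Finset.sum_add_distrib, Finset.sum_ite_eq'] at key
      have hle : (if p v ∈ S then z v - a else 0) ≤ z v - a := by split_ifs <;> linarith
      rw [Finset.sum_insert hv, Finset.sum_insert hv, Function.update_self, ← Nat.cast_sum,
        hsum S hv, Nat.cast_sum]
      linarith

/-- **Integrality of the fractional cover for subtree hypergraphs.**  For a
subtree hypergraph with non-negative integer weights, the minimum
`min { ∑_v y(v) : y ≥ 0, ∑_{v ∈ e} y(v) ≥ val(e) for all e ∈ E }` is attained
by a non-negative integer-valued function. -/
theorem subtree_hypergraph_integral_cover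
    {V : Type*} [Fintype V] [DecidableEq V]
    (E : Finset (Finset V)) (hE : IsSubtreeHypergraph E)
    (val : Finset V → ℕ) :
    ∃ y : V → ℕ, (∀ e ∈ E, val e ≤ ∑ v ∈ e, y v) ∧
      IsLeast {x : ℝ | ∃ z : V → ℝ, (∀ v, 0 ≤ z v) ∧
          (∀ e ∈ E, (val e : ℝ) ≤ ∑ v ∈ e, z v) ∧ x = ∑ v, z v}
        (∑ v, (y v : ℝ)) := by
  classical
  obtain ⟨T, hT, hTE⟩ := hE
  obtain ⟨r⟩ := hT.connected.nonempty
  obtain ⟨p, hp⟩ := hT.exists_parent r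
  obtain ⟨y, hy, hopt⟩ := exists_nat_cover_of_parent (T.dist r) p Finset.univ E id val
    (fun e he => ⟨Set.nonempty_coe_sort.mp (hTE e he).nonempty, Finset.subset_univ _,
      fun v hv u hu => by simpa using hp e (hTE e he) v (by simpa using hv) u (by simpa using hu)⟩)
  refine ⟨y, hy, ⟨fun v => y v, fun v => Nat.cast_nonneg _, fun e he => ?_, rfl⟩, ?_⟩
  · rw [← Nat.cast_sum]
    exact Nat.cast_le.mpr (hy e he)
  · rintro _ ⟨z, hz, hcov, rfl⟩
    exact hopt z hz hcov
end

section
/- Let D = (V, A) be a finite directed multigraph that contains a k-union-arborescence, and let H ⊆ A be such that D − H contains no k-union-arborescence and H is inclusionwise minimal with this property. Then there exists a subpartition 𝒳 of V such that 2 ≤ |𝒳| ≤ k + 1 and Σ_{X∈𝒳} ρ_{D−H}(X) = k(|𝒳| − 1) − 1. -/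
open scoped Finset

theorem rho_submodular {V A : Type*} [DecidableEq V] [Fintype A]
    (tl hd : A → V) (B : Finset A) (X Y : Finset V) :
    rho tl hd B (X ∩ Y) + rho tl hd B (X ∪ Y) ≤ rho tl hd B X + rho tl hd B Y := by
  simp only [rho, Finset.card_filter, ← Finset.sum_add_distrib]
  refine Finset.sum_le_sum fun a _ => ?_
  by_cases h₁ : tl a ∈ X <;> by_cases h₂ : tl a ∈ Y <;> by_cases h₃ : hd a ∈ X <;>
    by_cases h₄ : hd a ∈ Y <;> simp [h₁, h₂, h₃, h₄]

theorem rho_mono {V A : Type*} [DecidableEq V] [Fintype A]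
    (tl hd : A → V) {B C : Finset A} (h : B ⊆ C) (X : Finset V) :
    rho tl hd B X ≤ rho tl hd C X :=
  Finset.card_le_card (Finset.filter_subset_filter _ h)

theorem rho_univ {V A : Type*} [Fintype V] [DecidableEq V] [Fintype A]
    (tl hd : A → V) (B : Finset A) : rho tl hd B Finset.univ = 0 := by
  simp [rho]

theorem rho_insert {V A : Type*} [DecidableEq V] [Fintype A] [DecidableEq A]
    (tl hd : A → V) {B : Finset A} {a : A} (ha : a ∉ B) (X : Finset V) :
    rho tl hd (insert a B) X =
      rho tl hd B X + if tl a ∉ X ∧ hd a ∈ X then 1 else 0 := by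
  unfold rho
  rw [Finset.filter_insert]
  split_ifs with h
  · rw [Finset.card_insert_of_notMem (by simp [ha])]
  · simp

/-- The number of members of the family `R` that avoid `X` is supermodular in `X`. -/
theorem card_disjoint_supermodular {V ι : Type*} [DecidableEq V] [Fintype ι]
    (R : ι → Finset V) (X Y : Finset V) :
    #{j | Disjoint (R j) X} + #{j | Disjoint (R j) Y} ≤
      #{j | Disjoint (R j) (X ∩ Y)} + #{j | Disjoint (R j) (X ∪ Y)} := by
  simp only [Finset.card_filter, ← Finset.sum_add_distrib]
  refine Finset.sum_le_sum fun j _ => ?_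
  have h₁ : Disjoint (R j) X → Disjoint (R j) (X ∩ Y) :=
    fun h => h.mono_right Finset.inter_subset_left
  have h₂ : Disjoint (R j) Y → Disjoint (R j) (X ∩ Y) :=
    fun h => h.mono_right Finset.inter_subset_right
  simp only [Finset.disjoint_union_right]
  split_ifs <;> simp_all

/-- If two members of an intersecting pair both meet `R i` but their intersection does not, then
the supermodular inequality is strict. -/
theorem card_disjoint_supermodular_strict {V ι : Type*} [DecidableEq V] [Fintype ι]
    (R : ι → Finset V) (X Y : Finset V) (i : ι) (hX : ¬ Disjoint (R i) X)
    (hY : ¬ Disjoint (R i) Y) (hXY : Disjoint (R i) (X ∩ Y)) :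
    #{j | Disjoint (R j) X} + #{j | Disjoint (R j) Y} <
      #{j | Disjoint (R j) (X ∩ Y)} + #{j | Disjoint (R j) (X ∪ Y)} := by
  simp only [Finset.card_filter, ← Finset.sum_add_distrib]
  refine Finset.sum_lt_sum (fun j _ => ?_) ⟨i, Finset.mem_univ i, ?_⟩
  · have h₁ : Disjoint (R j) X → Disjoint (R j) (X ∩ Y) :=
      fun h => h.mono_right Finset.inter_subset_left
    have h₂ : Disjoint (R j) Y → Disjoint (R j) (X ∩ Y) :=
      fun h => h.mono_right Finset.inter_subset_right
    simp only [Finset.disjoint_union_right]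
    split_ifs <;> simp_all
  · simp [Finset.disjoint_union_right, hX, hY, hXY]

/-- Lovász's augmentation step for Edmonds' disjoint branchings theorem. -/
theorem exists_augmenting_arc {V A ι : Type*} [Fintype V] [DecidableEq V] [Fintype A]
    [DecidableEq A] [Fintype ι] [DecidableEq ι] (tl hd : A → V) (S : Finset A)
    (R : ι → Finset V) (hR : ∀ j, (R j).Nonempty)
    (hS : ∀ X : Finset V, X.Nonempty → #{j | Disjoint (R j) X} ≤ rho tl hd S X)
    (i : ι) (hi : R i ≠ Finset.univ) :
    ∃ a ∈ S, tl a ∈ R i ∧ hd a ∉ R i ∧ ∀ X : Finset V, X.Nonempty →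
      #{j | Disjoint (Function.update R i (insert (hd a) (R i)) j) X} ≤
        rho tl hd (S.erase a) X := by
  obtain ⟨X, hXmin⟩ : ∃ X : Finset V, Minimal (fun X => rho tl hd S X = #{j | Disjoint (R j) X} ∧
      ¬ Disjoint (R i) X ∧ ¬ X ⊆ R i) X := by
    refine (Set.toFinite {X : Finset V | rho tl hd S X = #{j | Disjoint (R j) X} ∧
      ¬ Disjoint (R i) X ∧ ¬ X ⊆ R i}).exists_minimal ⟨Finset.univ, ?_, ?_, ?_⟩
    · rw [rho_univ, eq_comm, Finset.card_eq_zero, Finset.filter_eq_empty_iff]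
      intro j _ h
      obtain ⟨v, hv⟩ := hR j
      exact Finset.disjoint_left.1 h hv (Finset.mem_univ v)
    · intro h
      obtain ⟨v, hv⟩ := hR i
      exact Finset.disjoint_left.1 h hv (Finset.mem_univ v)
    · exact fun h => hi (Finset.univ_subset_iff.1 h)
  obtain ⟨⟨hXt, hXd, hXs⟩, hmin⟩ := hXmin
  have hne : (X \ R i).Nonempty := Finset.sdiff_nonempty.2 hXs
  have hlt : rho tl hd S X < rho tl hd S (X \ R i) := by
    refine lt_of_lt_of_le ?_ (hS _ hne)
    rw [hXt]
    refine Finset.card_lt_card (Finset.ssubset_iff_of_subset ?_ |>.2 ⟨i, ?_, ?_⟩)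
    · intro j
      simp only [Finset.mem_filter, Finset.mem_univ, true_and]
      exact fun h => h.mono_right Finset.sdiff_subset
    · simpa using Finset.disjoint_sdiff
    · simpa using hXd
  obtain ⟨a, ha, ha'⟩ := Finset.exists_mem_notMem_of_card_lt_card hlt
  simp only [Finset.mem_filter, Finset.mem_sdiff, not_and, not_not] at ha ha'
  obtain ⟨haS, hat, haX, haR⟩ := ha
  have htX : tl a ∈ X := by
    by_contra h
    exact ha' haS h haX
  have htR : tl a ∈ R i := hat htX
  refine ⟨a, haS, htR, haR, fun Y hY => ?_⟩
  have hYS := hS Y hY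
  have hle : #{j | Disjoint (Function.update R i (insert (hd a) (R i)) j) Y} ≤
      #{j | Disjoint (R j) Y} := by
    refine Finset.card_le_card fun j => ?_
    simp only [Finset.mem_filter, Finset.mem_univ, true_and]
    rcases eq_or_ne j i with rfl | hj
    · rw [Function.update_self]
      exact fun h => h.mono_left (Finset.subset_insert _ _)
    · rw [Function.update_of_ne hj]
      exact id
  have hrho := rho_insert tl hd (Finset.notMem_erase a S) Y
  rw [Finset.insert_erase haS] at hrho
  by_cases hent : tl a ∉ Y ∧ hd a ∈ Y
  swap
  · rw [if_neg hent] at hrho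
    omega
  rw [if_pos hent] at hrho
  by_cases hd' : Disjoint (R i) Y
  · have : #{j | Disjoint (Function.update R i (insert (hd a) (R i)) j) Y} <
        #{j | Disjoint (R j) Y} := by
      refine Finset.card_lt_card (Finset.ssubset_iff_of_subset ?_ |>.2 ⟨i, ?_, ?_⟩)
      · intro j
        simp only [Finset.mem_filter, Finset.mem_univ, true_and]
        rcases eq_or_ne j i with rfl | hj
        · exact fun _ => hd'
        · rw [Function.update_of_ne hj]
          exact id
      · simpa using hd'
      · simp [hent.2]
    omega
  · have hnt : rho tl hd S Y ≠ #{j | Disjoint (R j) Y} := by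
      intro hYt
      have hsub := rho_submodular tl hd S X Y
      have hI := hS (X ∩ Y) ⟨hd a, by simp [haX, hent.2]⟩
      have hU := hS (X ∪ Y) ⟨hd a, by simp [haX]⟩
      by_cases hXY : Disjoint (R i) (X ∩ Y)
      · have := card_disjoint_supermodular_strict R X Y i hXd hd' hXY
        omega
      · have := card_disjoint_supermodular R X Y
        have hsubs := hmin (y := X ∩ Y) ⟨by omega, hXY, fun h =>
          haR (h (by simp [haX, hent.2]))⟩ Finset.inter_subset_left
        exact hent.1 (Finset.mem_inter.1 (hsubs htX)).2
    omega

/-- `B` is a spanning branching with root set `R`. -/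
def IsBranchingFrom {V A : Type*} [DecidableEq V] [Fintype A]
    (tl hd : A → V) (B : Finset A) (R : Finset V) : Prop :=
  (∀ v, rho tl hd B {v} = if v ∈ R then 0 else 1) ∧
    ∀ v, ∃ r ∈ R, Relation.ReflTransGen (Step tl hd B) r v

theorem IsBranchingFrom.isRArbor {V A : Type*} [DecidableEq V] [Fintype A]
    {tl hd : A → V} {B : Finset A} {r : V} (h : IsBranchingFrom tl hd B {r}) :
    IsRArbor tl hd B r := by
  refine ⟨by simpa using h.1 r, fun v hv => by simpa [hv] using h.1 v, fun v => ?_⟩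
  obtain ⟨s, hs, hsv⟩ := h.2 v
  rwa [Finset.mem_singleton.1 hs] at hsv

theorem IsBranchingFrom.insert_arc {V A : Type*} [DecidableEq V] [Fintype A] [DecidableEq A]
    {tl hd : A → V} {B : Finset A} {R : Finset V} {a : A} (ha : a ∉ B)
    (ht : tl a ∈ R) (hh : hd a ∉ R) (h : IsBranchingFrom tl hd B (insert (hd a) R)) :
    IsBranchingFrom tl hd (insert a B) R := by
  have hne : tl a ≠ hd a := fun e => hh (e ▸ ht)
  have hstep : ∀ u v, Step tl hd B u v → Step tl hd (insert a B) u v := by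
    rintro u v ⟨b, hb, h⟩
    exact ⟨b, Finset.mem_insert_of_mem hb, h⟩
  refine ⟨fun v => ?_, fun v => ?_⟩
  · rw [rho_insert tl hd ha, h.1 v]
    rcases eq_or_ne v (hd a) with rfl | hv
    · simp [hh, hne]
    · simp [hv, hv.symm]
  · obtain ⟨r, hr, hrv⟩ := h.2 v
    have hrv' := Relation.ReflTransGen.mono hstep _ _ hrv
    rcases Finset.mem_insert.1 hr with rfl | hr
    · exact ⟨tl a, ht, Relation.ReflTransGen.head ⟨a, Finset.mem_insert_self a B, rfl, rfl⟩ hrv'⟩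
    · exact ⟨r, hr, hrv'⟩

/-- Edmonds' disjoint branchings theorem. -/
theorem exists_disjoint_branchings {V A ι : Type*} [Fintype V] [DecidableEq V] [Fintype A]
    [DecidableEq A] [Fintype ι] [DecidableEq ι] (tl hd : A → V) (S : Finset A)
    (R : ι → Finset V) (hR : ∀ j, (R j).Nonempty)
    (hS : ∀ X : Finset V, X.Nonempty → #{j | Disjoint (R j) X} ≤ rho tl hd S X) :
    ∃ f : ι → Finset A, (∀ j, f j ⊆ S) ∧ (∀ i j, i ≠ j → Disjoint (f i) (f j)) ∧
      ∀ j, IsBranchingFrom tl hd (f j) (R j) := by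
  induction S using Finset.strongInduction generalizing R with
  | H S ih =>
  by_cases hall : ∀ j, R j = Finset.univ
  · refine ⟨fun _ => ∅, by simp, by simp, fun j => ⟨fun v => ?_, fun v => ⟨v, ?_, .refl⟩⟩⟩ <;>
      simp [hall, rho]
  push Not at hall
  obtain ⟨i, hi⟩ := hall
  obtain ⟨a, haS, ht, hh, hcond⟩ := exists_augmenting_arc tl hd S R hR hS i hi
  obtain ⟨f, hfS, hfd, hfb⟩ := ih (S.erase a) (Finset.erase_ssubset haS)
    (Function.update R i (insert (hd a) (R i))) (fun j => by
      rcases eq_or_ne j i with rfl | hj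
      · simp
      · simpa [hj] using hR j) hcond
  have haf : ∀ j, a ∉ f j := fun j h => Finset.notMem_erase a S (hfS j h)
  refine ⟨Function.update f i (insert a (f i)), fun j => ?_, fun j l hjl => ?_, fun j => ?_⟩
  · rcases eq_or_ne j i with rfl | hj
    · rw [Function.update_self]
      exact Finset.insert_subset haS ((hfS j).trans (Finset.erase_subset a S))
    · rw [Function.update_of_ne hj]
      exact (hfS j).trans (Finset.erase_subset a S)
  · rcases eq_or_ne j i with rfl | hj
    · simp [hjl.symm, haf, hfd _ _ hjl]
    · rcases eq_or_ne l i with rfl | hl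
      · simp [hj, haf, hfd _ _ hjl]
      · simp [hj, hl, hfd _ _ hjl]
  · have hb := hfb j
    rcases eq_or_ne j i with rfl | hj
    · rw [Function.update_self] at hb ⊢
      exact hb.insert_arc (haf j) ht hh
    · rwa [Function.update_of_ne hj] at hb ⊢

/-- Frank's root vector: under the subpartition condition there is a distribution of `k` roots
that satisfies Edmonds' cut condition. -/
theorem exists_root_vector {V A : Type*} [Fintype V] [Nonempty V] [DecidableEq V] [Fintype A]
    (tl hd : A → V) (S : Finset A) (k : ℕ)
    (hS : ∀ P : Finset (Finset V), IsSubpartition Finset.univ P →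
      k * #P ≤ ∑ X ∈ P, rho tl hd S X + k) :
    ∃ m : V → ℕ, ∑ v, m v = k ∧
      ∀ X : Finset V, X.Nonempty → k ≤ ∑ v ∈ X, m v + rho tl hd S X := by
  classical
  obtain ⟨m, hm⟩ := exists_minimal_of_wellFoundedLT
    (fun m : V → ℕ => ∀ X : Finset V, X.Nonempty → k ≤ ∑ v ∈ X, m v + rho tl hd S X)
    ⟨fun _ => k, fun X hX => by
      have := hX.card_pos
      simp only [Finset.sum_const, smul_eq_mul]
      nlinarith⟩
  obtain ⟨hcut, hmin⟩ := hm
  refine ⟨m, le_antisymm ?_ (by simpa [rho_univ] using hcut Finset.univ Finset.univ_nonempty),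
    hcut⟩
  let tight : Finset V → Prop := fun X => X.Nonempty ∧ ∑ v ∈ X, m v + rho tl hd S X = k
  have hunion : ∀ X Y, tight X → tight Y → ¬ Disjoint X Y → tight (X ∪ Y) := by
    intro X Y hX hY hXY
    have h₁ := hcut (X ∩ Y) (Finset.not_disjoint_iff_nonempty_inter.1 hXY)
    have hne : (X ∪ Y).Nonempty := hX.1.mono Finset.subset_union_left
    have h₂ := hcut (X ∪ Y) hne
    have h₃ := rho_submodular tl hd S X Y
    have h₄ := Finset.sum_union_inter (s₁ := X) (s₂ := Y) (f := m)
    have h₅ := hX.2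
    have h₆ := hY.2
    exact ⟨hne, by omega⟩
  have hcover : ∀ v, m v ≠ 0 → ∃ X, tight X ∧ v ∈ X := by
    intro v hv
    have hnot : ¬ ∀ X : Finset V, X.Nonempty →
        k ≤ ∑ u ∈ X, Function.update m v (m v - 1) u + rho tl hd S X := by
      intro h
      have hle : m v ≤ Function.update m v (m v - 1) v := hmin (y := Function.update m v (m v - 1)) h
        (update_le_self_iff.2 (Nat.sub_le _ _)) v
      rw [Function.update_self] at hle
      omega
    push Not at hnot
    obtain ⟨X, hX, hlt⟩ := hnot
    have hge := hcut X hX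
    by_cases hvX : v ∈ X
    · refine ⟨X, ⟨hX, ?_⟩, hvX⟩
      rw [Finset.sum_update_of_mem hvX] at hlt
      have := Finset.add_sum_erase X m hvX
      rw [← Finset.sdiff_singleton_eq_erase] at this
      omega
    · rw [Finset.sum_update_of_notMem hvX] at hlt
      omega
  let P : Finset (Finset V) := {X | Maximal tight X}
  have hPmem : ∀ X, X ∈ P ↔ Maximal tight X := by simp [P]
  have hdisj : ∀ X ∈ P, ∀ Y ∈ P, X ≠ Y → Disjoint X Y := by
    intro X hX Y hY hne
    rw [hPmem] at hX hY
    by_contra hXY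
    have hU := hunion X Y hX.prop hY.prop hXY
    exact hne ((hX.eq_of_le hU Finset.subset_union_left).trans
      (hY.eq_of_le hU Finset.subset_union_right).symm)
  have hP := hS P ⟨fun X hX => ⟨((hPmem X).1 hX).prop.1, Finset.subset_univ X⟩, hdisj⟩
  have hsum : ∑ v, m v = ∑ X ∈ P, ∑ v ∈ X, m v := by
    rw [← Finset.sum_biUnion (fun X hX Y hY h => hdisj X hX Y hY h)]
    refine (Finset.sum_subset (Finset.subset_univ _) fun v _ hv => ?_).symm
    by_contra hmv
    obtain ⟨X, hX, hvX⟩ := hcover v hmv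
    obtain ⟨Y, hXY, hY⟩ := (Set.toFinite {X | tight X}).exists_le_maximal hX
    exact hv (Finset.mem_biUnion.2 ⟨Y, (hPmem Y).2 hY, hXY hvX⟩)
  have htight : ∑ X ∈ P, (∑ v ∈ X, m v + rho tl hd S X) = k * #P := by
    rw [Finset.sum_congr rfl fun X hX => ((hPmem X).1 hX).prop.2]
    simp [mul_comm]
  rw [Finset.sum_add_distrib] at htight
  omega

/-- Frank's theorem, sufficiency: the subpartition condition yields `k` arc-disjoint spanning
arborescences. -/
theorem hasKUnionArborOn_of_subpartition {V A : Type*} [Fintype V] [Nonempty V] [DecidableEq V]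
    [Fintype A] [DecidableEq A] (tl hd : A → V) (S : Finset A) (k : ℕ)
    (hS : ∀ P : Finset (Finset V), IsSubpartition Finset.univ P →
      k * #P ≤ ∑ X ∈ P, rho tl hd S X + k) :
    HasKUnionArborOn tl hd S k := by
  obtain ⟨m, hmk, hm⟩ := exists_root_vector tl hd S k hS
  have hcard : Fintype.card (Fin k) = Fintype.card (Σ v, Fin (m v)) := by simp [hmk]
  let e : Fin k ≃ Σ v, Fin (m v) := Fintype.equivOfCardEq hcard
  have hroots : ∀ X : Finset V, #{i | (e i).1 ∈ X} = ∑ v ∈ X, m v := by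
    intro X
    have : #(X.sigma fun v => (Finset.univ : Finset (Fin (m v)))) = ∑ v ∈ X, m v := by simp
    rw [← this]
    exact Finset.card_equiv e (by simp)
  obtain ⟨f, hfS, hfd, hfb⟩ := exists_disjoint_branchings tl hd S (fun i => {(e i).1})
    (by simp) (fun X hX => by
      have h₁ := Finset.card_filter_add_card_filter_not (s := Finset.univ)
        (fun i : Fin k => (e i).1 ∈ X)
      rw [hroots, Finset.card_univ, Fintype.card_fin] at h₁
      have h₂ := hm X hX
      simp only [Finset.disjoint_singleton_left]
      omega)
  exact ⟨Finset.univ.biUnion f, Finset.biUnion_subset.2 fun i _ => hfS i, f,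
    fun i => ⟨_, (hfb i).isRArbor⟩, hfd, rfl⟩

theorem IsRArbor.one_le_rho {V A : Type*} [DecidableEq V] [Fintype A] {tl hd : A → V}
    {B : Finset A} {r : V} (h : IsRArbor tl hd B r) {X : Finset V} (hX : X.Nonempty)
    (hr : r ∉ X) : 1 ≤ rho tl hd B X := by
  obtain ⟨v, hv⟩ := hX
  by_contra hlt
  have hempty : B.filter (fun a => tl a ∉ X ∧ hd a ∈ X) = ∅ :=
    Finset.card_eq_zero.1 (Nat.lt_one_iff.1 (not_le.1 hlt))
  have hout : ∀ u, Relation.ReflTransGen (Step tl hd B) r u → u ∉ X := by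
    intro u hu
    induction hu with
    | refl => exact hr
    | tail _ hs ih =>
      obtain ⟨a, ha, rfl, rfl⟩ := hs
      exact fun hmem => Finset.filter_eq_empty_iff.1 hempty ha ⟨ih, hmem⟩
  exact hout v (h.2.2 v) hv

theorem IsRArbor.card_le_sum_rho {V A : Type*} [Fintype V] [DecidableEq V] [Fintype A]
    {tl hd : A → V} {B : Finset A} {r : V} (h : IsRArbor tl hd B r) {P : Finset (Finset V)}
    (hP : IsSubpartition Finset.univ P) : #P ≤ ∑ X ∈ P, rho tl hd B X + 1 := by
  have h₁ : #{X ∈ P | r ∈ X} ≤ 1 := by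
    refine Finset.card_le_one.2 fun X hX Y hY => ?_
    rw [Finset.mem_filter] at hX hY
    by_contra hne
    exact Finset.disjoint_left.1 (hP.2 X hX.1 Y hY.1 hne) hX.2 hY.2
  have h₂ : #{X ∈ P | r ∉ X} ≤ ∑ X ∈ P, rho tl hd B X := by
    rw [Finset.card_filter]
    refine Finset.sum_le_sum fun X hX => ?_
    split_ifs with hr
    · exact Nat.zero_le _
    · exact h.one_le_rho (hP.1 X hX).1 hr
  have h₃ := Finset.card_filter_add_card_filter_not (s := P) (fun X => r ∈ X)
  omega

/-- Frank's theorem, necessity of the subpartition condition. -/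
theorem HasKUnionArborOn.subpartition {V A : Type*} [Fintype V] [DecidableEq V]
    [Fintype A] [DecidableEq A] {tl hd : A → V} {S : Finset A} {k : ℕ}
    (h : HasKUnionArborOn tl hd S k) {P : Finset (Finset V)}
    (hP : IsSubpartition Finset.univ P) : k * #P ≤ ∑ X ∈ P, rho tl hd S X + k := by
  obtain ⟨_, hBS, f, hf, hfd, rfl⟩ := h
  have hrho : ∀ X, rho tl hd (Finset.univ.biUnion f) X = ∑ i, rho tl hd (f i) X := by
    intro X
    unfold rho
    rw [Finset.filter_biUnion, Finset.card_biUnion]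
    exact fun i _ j _ hij => Finset.disjoint_filter_filter (hfd i j hij)
  calc k * #P = ∑ _i : Fin k, #P := by simp
    _ ≤ ∑ i, (∑ X ∈ P, rho tl hd (f i) X + 1) :=
      Finset.sum_le_sum fun i _ => (hf i).elim fun _ hr => hr.card_le_sum_rho hP
    _ = ∑ X ∈ P, rho tl hd (Finset.univ.biUnion f) X + k := by
      simp only [hrho, Finset.sum_add_distrib]
      rw [Finset.sum_comm]
      simp
    _ ≤ ∑ X ∈ P, rho tl hd S X + k := by
      gcongr with X hX
      exact rho_mono tl hd hBS X

theorem sum_rho_insert_le {V A : Type*} [Fintype V] [DecidableEq V] [Fintype A] [DecidableEq A]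
    (tl hd : A → V) {B : Finset A} {a : A} (ha : a ∉ B) {P : Finset (Finset V)}
    (hP : IsSubpartition Finset.univ P) :
    ∑ X ∈ P, rho tl hd (insert a B) X ≤ ∑ X ∈ P, rho tl hd B X + 1 := by
  simp only [rho_insert tl hd ha, Finset.sum_add_distrib, ← Finset.card_filter]
  refine Nat.add_le_add_left (Finset.card_le_one.2 fun X hX Y hY => ?_) _
  rw [Finset.mem_filter] at hX hY
  by_contra hne
  exact Finset.disjoint_left.1 (hP.2 X hX.1 Y hY.1 hne) hX.2.2 hY.2.2

/-- If `D` contains a `k`-union-arborescence and `H` is an inclusionwise minimal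
arc set such that `D - H` contains no `k`-union-arborescence, then there is a
subpartition `𝒳` of `V` with `2 ≤ |𝒳| ≤ k + 1` and
`∑_{X ∈ 𝒳} ρ_{D-H}(X) = k(|𝒳| - 1) - 1`. -/
theorem minimal_blocker_tight_subpartition
    {V A : Type*} [Fintype V] [DecidableEq V] [Fintype A] [DecidableEq A]
    (tl hd : A → V) (k : ℕ) (hk : 0 < k)
    (hD : HasKUnionArborOn tl hd Finset.univ k)
    (H : Finset A)
    (hblock : ¬ HasKUnionArborOn tl hd (Finset.univ \ H) k)
    (hmin : ∀ H' : Finset A, H' ⊂ H → HasKUnionArborOn tl hd (Finset.univ \ H') k) :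
    ∃ P : Finset (Finset V), IsSubpartition Finset.univ P ∧
      2 ≤ P.card ∧ P.card ≤ k + 1 ∧
      (∑ X ∈ P, (rho tl hd (Finset.univ \ H) X : ℤ)) =
        (k : ℤ) * ((P.card : ℤ) - 1) - 1 := by
  classical
  have : Nonempty V := by
    obtain ⟨_, _, f, hf, _⟩ := hD
    exact (hf ⟨0, hk⟩).elim fun r _ => ⟨r⟩
  obtain ⟨P, hPmin⟩ : ∃ P : Finset (Finset V), Minimal (fun P => IsSubpartition Finset.univ P ∧
      ∑ X ∈ P, rho tl hd (Finset.univ \ H) X + k < k * #P) P := by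
    have hviol := mt (hasKUnionArborOn_of_subpartition tl hd (Finset.univ \ H) k) hblock
    push Not at hviol
    exact (Set.toFinite {P : Finset (Finset V) | IsSubpartition Finset.univ P ∧
      ∑ X ∈ P, rho tl hd (Finset.univ \ H) X + k < k * #P}).exists_minimal hviol
  obtain ⟨⟨hP, hlt⟩, hmin'⟩ := hPmin
  have htwo : 2 ≤ #P := by
    by_contra h
    have : k * #P ≤ k * 1 := Nat.mul_le_mul_left k (by omega)
    omega
  obtain ⟨a, haH⟩ : H.Nonempty := by
    rw [Finset.nonempty_iff_ne_empty]
    rintro rfl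
    exact hblock (by simpa using hD)
  have haux : Finset.univ \ H.erase a = insert a (Finset.univ \ H) := by
    ext b
    by_cases hb : b = a <;> simp [hb]
  have hge : k * #P ≤ ∑ X ∈ P, rho tl hd (Finset.univ \ H) X + 1 + k := by
    have h₁ := (hmin (H.erase a) (Finset.erase_ssubset haH)).subpartition hP
    rw [haux] at h₁
    have h₂ := sum_rho_insert_le tl hd (B := Finset.univ \ H) (a := a) (by simp [haH]) hP
    omega
  have hsmall : ∀ X ∈ P, rho tl hd (Finset.univ \ H) X + 1 ≤ k := by
    intro X hX
    by_contra hbig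
    have hsum := Finset.add_sum_erase P (rho tl hd (Finset.univ \ H)) hX
    have hmul : k * #P = k * #(P.erase X) + k := by
      rw [← Finset.card_erase_add_one hX, mul_add, mul_one]
    have hsub := hmin' (y := P.erase X)
      ⟨⟨fun Y hY => hP.1 Y (Finset.mem_of_mem_erase hY), fun Y hY Z hZ =>
        hP.2 Y (Finset.mem_of_mem_erase hY) Z (Finset.mem_of_mem_erase hZ)⟩, by omega⟩
      (Finset.erase_subset X P)
    exact Finset.notMem_erase X P (hsub hX)
  have hle : ∑ X ∈ P, rho tl hd (Finset.univ \ H) X + #P ≤ k * #P := by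
    have h := Finset.sum_le_sum hsmall
    simpa [Finset.sum_add_distrib, mul_comm] using h
  refine ⟨P, hP, htwo, by omega, ?_⟩
  have heq : ∑ X ∈ P, rho tl hd (Finset.univ \ H) X + 1 + k = k * #P := by omega
  have heq' : (∑ X ∈ P, (rho tl hd (Finset.univ \ H) X : ℤ)) + 1 + k = k * #P := by
    exact_mod_cast heq
  linarith
end

section
/- Insolidity of the minimal minimizer in the dual-lowering step: Let D = (V, A) be a finite directed multigraph, k a positive integer, and y : V → ℤ≥0 a function satisfying Σ_{u∈X} y(u) ≥ k − ρ_D(X) for every non-empty X ⊆ V. Let v ∈ U ⊆ V, and let Z be an inclusionwise minimal set among the minimizers of min{ρ_D(X) + Σ_{u∈X} y(u) : v ∈ X ⊆ U}. If Σ_{u∈Z−v} y(u) < k − ρ_D(Z), then Z is an insolid set of D. -/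
/-- **Insolidity of the minimal minimizer in the dual-lowering step.**
Suppose `y : V → ℕ` satisfies `∑_{u ∈ X} y(u) ≥ k - ρ(X)` for every non-empty
`X`, let `v ∈ U`, and let `Z` be an inclusionwise minimal set among the
minimizers of `min { ρ(X) + ∑_{u ∈ X} y(u) : v ∈ X ⊆ U }`.  If
`∑_{u ∈ Z - v} y(u) < k - ρ(Z)`, then `Z` is in-solid. -/
theorem minimal_minimizer_insolid
    {V A : Type*} [Fintype V] [DecidableEq V] [Fintype A] [DecidableEq A]
    (tl hd : A → V) (k : ℕ) (hk : 0 < k) (y : V → ℕ)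
    (hy : ∀ X : Finset V, X.Nonempty →
        (k : ℤ) - (rho tl hd Finset.univ X : ℤ) ≤ ∑ u ∈ X, (y u : ℤ))
    (U : Finset V) (v : V) (hv : v ∈ U)
    (Z : Finset V) (hvZ : v ∈ Z) (hZU : Z ⊆ U)
    (hminzer : ∀ X : Finset V, v ∈ X → X ⊆ U →
        rho tl hd Finset.univ Z + ∑ u ∈ Z, y u ≤
          rho tl hd Finset.univ X + ∑ u ∈ X, y u)
    (hminimal : ∀ X : Finset V, v ∈ X → X ⊂ Z →
        rho tl hd Finset.univ Z + ∑ u ∈ Z, y u <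
          rho tl hd Finset.univ X + ∑ u ∈ X, y u)
    (hlt : (∑ u ∈ Z.erase v, (y u : ℤ)) < (k : ℤ) - (rho tl hd Finset.univ Z : ℤ)) :
    Insolid tl hd Z := by
  refine ⟨⟨v, hvZ⟩, fun Y hY hYZ => ?_⟩
  by_cases hvY : v ∈ Y
  · have hlt_sum := hminimal Y hvY hYZ
    have hsum : ∑ u ∈ Y, y u ≤ ∑ u ∈ Z, y u :=
      Finset.sum_le_sum_of_subset hYZ.subset
    lia
  · have hcover := hy Y hY
    have hsum : ∑ u ∈ Y, (y u : ℤ) ≤ ∑ u ∈ Z.erase v, (y u : ℤ) :=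
      Finset.sum_le_sum_of_subset_of_nonneg
        (Finset.subset_erase.2 ⟨hYZ.subset, hvY⟩) fun _ _ _ => Int.natCast_nonneg _
    lia
end

section
/- Correctness of the fixed-size subpartition formula: Let D = (V, A) be a finite directed multigraph with non-negative arc weights w : A → ℝ≥0, let T be a tree spanning V such that every insolid set of the weighted digraph D_w induces a subtree of T, and let t be a positive integer with 2 ≤ t ≤ |V|. Then min{Σ_{X∈𝒳} ρ_{D_w}(X) : 𝒳 is a subpartition of V with |𝒳| = t} equals the minimum, over all subsets F of the edge set of T with |F| = t − 1 (whose removal splits T into components with vertex sets Z_1, …, Z_t), of Σ_{i=1}^{t} min{ρ_{D_w}(X) : ∅ ≠ X ⊆ Z_i}. -/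
lemma exists_insolidW_subset_le {V A : Type*} [DecidableEq V] [Fintype A]
    (tl hd : A → V) (w : A → ℝ) {X : Finset V} (hX : X.Nonempty) :
    ∃ Y ⊆ X, InsolidW tl hd w Y ∧
      rhoW tl hd w Finset.univ Y ≤ rhoW tl hd w Finset.univ X := by
  induction X using Finset.strongInduction with
  | H X ih =>
    by_cases h : ∃ Y : Finset V, Y.Nonempty ∧ Y ⊂ X ∧
        rhoW tl hd w Finset.univ Y ≤ rhoW tl hd w Finset.univ X
    · obtain ⟨Y, hY, hYX, hle⟩ := h
      obtain ⟨W, hWY, hW, hWle⟩ := ih Y hYX hY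
      exact ⟨W, hWY.trans hYX.subset, hW, hWle.trans hle⟩
    · push Not at h
      exact ⟨X, subset_rfl, ⟨hX, h⟩, le_rfl⟩

/-- Disjoint connected sets of a finite connected graph extend to a partition of the vertex set
into connected sets, given as the fibres of a map. -/
lemma SimpleGraph.Connected.exists_fiber_connected {V ι : Type*} [Finite V] [Finite ι] [Nonempty ι]
    {G : SimpleGraph V} (hG : G.Connected) (X : ι → Set V)
    (hdisj : Pairwise fun i j => Disjoint (X i) (X j))
    (hconn : ∀ i, (G.induce (X i)).Connected) :
    ∃ f : V → ι, (∀ i, X i ⊆ f ⁻¹' {i}) ∧ ∀ i, (G.induce (f ⁻¹' {i})).Connected := by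
  classical
  obtain ⟨Z, hXZ, hZ⟩ := Finite.exists_le_maximal
    (p := fun Z : ι → Set V => (Pairwise fun i j => Disjoint (Z i) (Z j)) ∧
      ∀ i, (G.induce (Z i)).Connected) ⟨hdisj, hconn⟩
  obtain ⟨hZd, hZc⟩ := hZ.prop
  have hcover : ∀ v, ∃ i, v ∈ Z i := by
    by_contra! h
    obtain ⟨v, hv⟩ := h
    obtain ⟨⟨u, hu⟩⟩ := (hZc (Classical.arbitrary ι)).nonempty
    obtain ⟨p⟩ := hG.preconnected u v
    obtain ⟨d, -, hd₁, hd₂⟩ := p.exists_boundary_dart (⋃ i, Z i)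
      (Set.mem_iUnion.2 ⟨_, hu⟩) (by simpa using hv)
    obtain ⟨i, hi⟩ := Set.mem_iUnion.1 hd₁
    have hb : ∀ j, d.snd ∉ Z j := by simpa using hd₂
    have hle : Z ≤ Function.update Z i (Z i ∪ {d.snd}) := by
      intro j
      by_cases hj : j = i
      · subst hj; simp
      · simp [hj]
    have hP : (Pairwise fun j k => Disjoint (Function.update Z i (Z i ∪ {d.snd}) j)
        (Function.update Z i (Z i ∪ {d.snd}) k)) ∧
        ∀ j, (G.induce (Function.update Z i (Z i ∪ {d.snd}) j)).Connected := by
      refine ⟨fun j k hjk => ?_, fun j => ?_⟩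
      · have := hZd hjk
        by_cases hj : j = i
        · subst hj
          simp [Function.update_of_ne hjk.symm, this, hb]
        · by_cases hk : k = i
          · subst hk
            simp [Function.update_of_ne hjk, this, hb]
          · simpa [hj, hk] using this
      · by_cases hj : j = i
        · subst hj
          rw [Function.update_self]
          exact SimpleGraph.connected_induce_union (hZc j).preconnected
            SimpleGraph.Preconnected.of_subsingleton hi rfl d.adj
        · rw [Function.update_of_ne hj]
          exact hZc j
    have := hZ.2 hP hle i
    exact hb i (this (by simp))
  choose f hf using hcover
  have hfib : ∀ i, f ⁻¹' {i} = Z i := by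
    intro i
    ext v
    refine ⟨fun h => h ▸ hf v, fun h => ?_⟩
    by_contra hne
    exact Set.disjoint_left.1 (hZd hne) (hf v) h
  exact ⟨f, fun i => (hfib i).symm ▸ hXZ i, fun i => (hfib i).symm ▸ hZc i⟩

lemma SimpleGraph.reachable_iff_of_fiber_connected {V ι : Type*} {G H : SimpleGraph V} {f : V → ι}
    (hconn : ∀ i, (G.induce (f ⁻¹' {i})).Connected)
    (hH : ∀ u v, H.Adj u v ↔ G.Adj u v ∧ f u = f v) (u v : V) :
    H.Reachable u v ↔ f u = f v := by
  constructor
  · rintro ⟨p⟩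
    induction p with
    | nil => rfl
    | cons h p ih => exact ((hH _ _).1 h).2.trans ih
  · intro h
    let φ : G.induce (f ⁻¹' {f v}) →g H :=
      ⟨Subtype.val, fun {a b} hab => (hH _ _).2 ⟨hab, a.2.trans b.2.symm⟩⟩
    exact ((hconn (f v)).preconnected ⟨u, h⟩ ⟨v, rfl⟩).map φ

/-- If the fibres of a map on the vertices of a finite tree are connected, then the number of
edges joining distinct fibres is one less than the number of fibres. -/
lemma SimpleGraph.IsTree.card_filter_edgeFinset_map_not_isDiag {V ι : Type*} [Fintype V]
    [Fintype ι] [DecidableEq ι] {T : SimpleGraph V} [Fintype T.edgeSet] (hT : T.IsTree) (f : V → ι)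
    (hconn : ∀ i, (T.induce (f ⁻¹' {i})).Connected) :
    (T.edgeFinset.filter fun e => ¬ (e.map f).IsDiag).card + 1 = Fintype.card ι := by
  classical
  have hfib : ∀ i, (T.edgeFinset.filter fun e => e.map f = s(i, i)).card + 1 =
      (Finset.univ.filter fun v => f v = i).card := by
    intro i
    have htree : (T.induce (f ⁻¹' {i})).IsTree := ⟨hconn i, hT.isAcyclic.induce _⟩
    have h := htree.card_edgeFinset
    have hmap : T.edgeFinset.filter (fun e => e.map f = s(i, i)) =
        (T.induce (f ⁻¹' {i})).edgeFinset.map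
          ⟨Sym2.map Subtype.val, Sym2.map.injective Subtype.val_injective⟩ := by
      ext e
      induction e with
      | _ a b =>
      simp only [Finset.mem_filter, SimpleGraph.mem_edgeFinset, SimpleGraph.mem_edgeSet,
        Finset.mem_map, Function.Embedding.coeFn_mk, Sym2.map_mk]
      constructor
      · rintro ⟨hab, he⟩
        have hab' : f a = i ∧ f b = i := by simpa using he
        exact ⟨s(⟨a, hab'.1⟩, ⟨b, hab'.2⟩), hab, rfl⟩
      · rintro ⟨e, he, hee⟩
        induction e with
        | _ x y =>
        have hx : f x = i := x.2
        have hy : f y = i := y.2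
        have hxy : T.Adj x y := he
        rw [Sym2.map_mk, Sym2.eq_iff] at hee
        rcases hee with ⟨rfl, rfl⟩ | ⟨rfl, rfl⟩
        · exact ⟨hxy, by simp [hx, hy]⟩
        · exact ⟨hxy.symm, by simp [hx, hy]⟩
    rw [hmap, Finset.card_map, h, Fintype.card_subtype]
    simp only [Set.mem_preimage, Set.mem_singleton_iff]
  have hdiag : (T.edgeFinset.filter fun e => (e.map f).IsDiag).card =
      ∑ i, (T.edgeFinset.filter fun e => e.map f = s(i, i)).card := by
    rw [← Finset.card_biUnion]
    · congr 1
      ext e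
      induction e with
      | _ a b =>
        simp only [Finset.mem_filter, Finset.mem_biUnion, Finset.mem_univ, true_and, Sym2.map_mk,
          Sym2.mk_isDiag_iff, Sym2.eq_iff, or_self, exists_and_left]
        grind
    · intro i _ j _ hij
      rw [Function.onFun, Finset.disjoint_filter]
      intro e _ hi hj
      exact hij (by simpa using hi.symm.trans hj)
  have hsum : ∑ i, (Finset.univ.filter fun v => f v = i).card = Fintype.card V :=
    (Finset.card_eq_sum_card_fiberwise (fun v _ => Finset.mem_univ (f v))).symm
  have hsplit := Finset.card_filter_add_card_filter_not (s := T.edgeFinset)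
    (fun e => (e.map f).IsDiag)
  have hE := hT.card_edgeFinset
  simp_rw [← hfib, Finset.sum_add_distrib, ← hdiag] at hsum
  simp at hsum
  omega

/-- **Correctness of the fixed-size subpartition formula.**  Let `T` be a
spanning tree such that every in-solid set of the arc-weighted digraph induces
a subtree of `T` and let `2 ≤ t ≤ |V|`.  Then
`min { ∑_{X ∈ 𝒳} ρ_w(X) : 𝒳 subpartition of V, |𝒳| = t }` equals the minimum,
over all sets `F` of `t - 1` edges of `T` (whose removal splits `T` into
components `Z_1, …, Z_t`), of `∑_i min { ρ_w(X) : ∅ ≠ X ⊆ Z_i }`. -/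
theorem best_fixed_size_subpartition
    {V A : Type*} [Fintype V] [DecidableEq V] [Fintype A] [DecidableEq A]
    (tl hd : A → V) (w : A → ℝ) (hw : ∀ a, 0 ≤ w a)
    (T : SimpleGraph V) (hT : T.IsTree)
    (hrep : ∀ X : Finset V, InsolidW tl hd w X → (T.induce (X : Set V)).Connected)
    (t : ℕ) (ht2 : 2 ≤ t) (htV : t ≤ Fintype.card V) :
    ∃ m : ℝ,
      IsLeast {x : ℝ | ∃ P : Finset (Finset V),
          IsSubpartition Finset.univ P ∧ P.card = t ∧
          x = ∑ X ∈ P, rhoW tl hd w Finset.univ X} m ∧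
      IsLeast {x : ℝ | ∃ (F : Finset (Sym2 V)) (Z : Fin t → Finset V),
          (F : Set (Sym2 V)) ⊆ T.edgeSet ∧ F.card = t - 1 ∧
          (∀ i, IsCompOf (T.deleteEdges (F : Set (Sym2 V))) ((Z i : Set V))) ∧
          (∀ u : V, ∃ i, u ∈ Z i) ∧
          (∀ i j, i ≠ j → Z i ≠ Z j) ∧
          x = ∑ i : Fin t,
                sInf {c : ℝ | ∃ X : Finset V, X.Nonempty ∧ X ⊆ Z i ∧
                  c = rhoW tl hd w Finset.univ X}} m := by
  classical
  have hbdd : ∀ Z : Finset V, ∀ X : Finset V, X.Nonempty → X ⊆ Z →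
      sInf {c : ℝ | ∃ X : Finset V, X.Nonempty ∧ X ⊆ Z ∧ c = rhoW tl hd w Finset.univ X} ≤
        rhoW tl hd w Finset.univ X := fun Z X hX hXZ =>
    csInf_le ⟨0, by rintro c ⟨Y, -, -, rfl⟩; exact Finset.sum_nonneg fun a _ => hw a⟩
      ⟨X, hX, hXZ, rfl⟩
  have hattain : ∀ Z : Finset V, Z.Nonempty → ∃ X : Finset V, X.Nonempty ∧ X ⊆ Z ∧
      sInf {c : ℝ | ∃ X : Finset V, X.Nonempty ∧ X ⊆ Z ∧ c = rhoW tl hd w Finset.univ X} =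
        rhoW tl hd w Finset.univ X := by
    intro Z hZ
    refine Set.Nonempty.csInf_mem (s := {c : ℝ | ∃ X : Finset V, X.Nonempty ∧ X ⊆ Z ∧
      c = rhoW tl hd w Finset.univ X}) ⟨_, Z, hZ, subset_rfl, rfl⟩ ?_
    refine (Set.finite_range fun X : Finset V => rhoW tl hd w Finset.univ X).subset ?_
    rintro c ⟨X, -, -, rfl⟩
    exact ⟨X, rfl⟩
  obtain ⟨P, ⟨hP, hPt⟩, hPmin⟩ := Set.exists_min_image
    {P : Finset (Finset V) | IsSubpartition Finset.univ P ∧ P.card = t}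
    (fun P => ∑ X ∈ P, rhoW tl hd w Finset.univ X) (Set.toFinite _) (by
      obtain ⟨S, -, hS⟩ := Finset.exists_subset_card_eq (s := (Finset.univ : Finset V)) htV
      refine ⟨S.image fun v => {v}, ⟨?_, ?_⟩, ?_⟩
      · simp
      · simp only [Finset.mem_image]
        rintro _ ⟨u, -, rfl⟩ _ ⟨v, -, rfl⟩ huv
        simpa using fun h : u = v => huv (by rw [h])
      · rw [Finset.card_image_of_injective _ Finset.singleton_injective, hS])
  have hlower : ∀ Z : Fin t → Finset V, (∀ i, (Z i).Nonempty) →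
      (∀ i j, i ≠ j → Disjoint (Z i) (Z j)) →
      ∑ X ∈ P, rhoW tl hd w Finset.univ X ≤ ∑ i : Fin t,
        sInf {c : ℝ | ∃ X : Finset V, X.Nonempty ∧ X ⊆ Z i ∧
          c = rhoW tl hd w Finset.univ X} := by
    intro Z hZ hZd
    choose X hX hXZ hXeq using fun i => hattain (Z i) (hZ i)
    have hXd : ∀ i j, i ≠ j → Disjoint (X i) (X j) := fun i j hij =>
      (hZd i j hij).mono (hXZ i) (hXZ j)
    have hinj : Function.Injective X := by
      intro i j hij
      by_contra hne
      have := hXd i j hne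
      rw [hij, disjoint_self] at this
      exact (hX j).ne_empty this
    have := hPmin (Finset.univ.image X) ⟨⟨by simpa using hX, by
      simp only [Finset.mem_image]
      rintro _ ⟨i, -, rfl⟩ _ ⟨j, -, rfl⟩ hij
      exact hXd i j fun h => hij (by rw [h])⟩,
      by rw [Finset.card_image_of_injective _ hinj, Finset.card_univ, Fintype.card_fin]⟩
    rw [Finset.sum_image fun i _ j _ h => hinj h] at this
    simpa only [hXeq] using this
  have hlower' : ∀ (H : SimpleGraph V) (Z : Fin t → Finset V),
      (∀ i, IsCompOf H (Z i : Set V)) → (∀ i j, i ≠ j → Z i ≠ Z j) →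
      ∑ X ∈ P, rhoW tl hd w Finset.univ X ≤ ∑ i : Fin t,
        sInf {c : ℝ | ∃ X : Finset V, X.Nonempty ∧ X ⊆ Z i ∧
          c = rhoW tl hd w Finset.univ X} := by
    intro H Z hZ hZne
    choose r hr using hZ
    have hmem : ∀ i u, u ∈ Z i ↔ H.Reachable (r i) u := fun i u => by
      rw [← Finset.mem_coe, hr]; rfl
    refine hlower Z (fun i => ⟨r i, (hmem _ _).2 SimpleGraph.Reachable.rfl⟩) fun i j hij => ?_
    rw [Finset.disjoint_left]
    intro u hi hj
    rw [hmem] at hi hj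
    refine hZne i j hij (Finset.ext fun x => ?_)
    rw [hmem, hmem]
    exact ⟨fun h => hj.trans (hi.symm.trans h), fun h => hi.trans (hj.symm.trans h)⟩
  refine ⟨_, ⟨⟨P, hP, hPt, rfl⟩, ?_⟩, ?_, ?_⟩
  · rintro x ⟨Q, hQ, hQt, rfl⟩
    exact hPmin Q ⟨hQ, hQt⟩
  · let e : Fin t ≃ P := (P.equivFinOfCardEq hPt).symm
    choose X hXP hXins hXle using fun i : Fin t =>
      exists_insolidW_subset_le tl hd w (hP.1 (e i) (e i).2).1
    have : Nonempty (Fin t) := ⟨⟨0, by omega⟩⟩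
    obtain ⟨f, hXf, hf⟩ := hT.connected.exists_fiber_connected (fun i => (X i : Set V))
      (fun i j hij => Finset.disjoint_coe.2 <| (hP.2 _ (e i).2 _ (e j).2 fun h =>
        hij (e.injective (Subtype.ext h))).mono (hXP i) (hXP j))
      (fun i => hrep _ (hXins i))
    have hne : ∀ i, ∃ v, f v = i := fun i => by
      obtain ⟨v, hv⟩ := (hXins i).1
      exact ⟨v, hXf i hv⟩
    let F := T.edgeFinset.filter fun e => ¬ (e.map f).IsDiag
    have hreach := SimpleGraph.reachable_iff_of_fiber_connected
      (H := T.deleteEdges (F : Set (Sym2 V))) hf (by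
        intro u v
        simp only [SimpleGraph.deleteEdges_adj, F, Finset.coe_filter, Set.mem_ofPred_eq,
          SimpleGraph.mem_edgeFinset, SimpleGraph.mem_edgeSet, Sym2.map_mk,
          Sym2.mk_isDiag_iff]
        tauto)
    have hcomp : ∀ i, IsCompOf (T.deleteEdges (F : Set (Sym2 V)))
        ((Finset.univ.filter fun v => f v = i : Finset V) : Set V) := by
      intro i
      obtain ⟨v, rfl⟩ := hne i
      refine ⟨v, ?_⟩
      ext u
      simp [hreach, eq_comm]
    have hZne : ∀ i j, i ≠ j →
        (Finset.univ.filter fun v => f v = i) ≠ Finset.univ.filter fun v => f v = j := by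
      intro i j hij h
      obtain ⟨v, rfl⟩ := hne i
      have hv : v ∈ Finset.univ.filter fun u => f u = j := h ▸ by simp
      exact hij (by simpa using hv)
    refine ⟨F, fun i => Finset.univ.filter fun v => f v = i, ?_, ?_, hcomp, by simp, hZne,
      le_antisymm (hlower' _ _ hcomp hZne) ?_⟩
    · intro e he
      exact SimpleGraph.mem_edgeFinset.1 (Finset.mem_filter.1 he).1
    · have := hT.card_filter_edgeFinset_map_not_isDiag f hf
      rw [Fintype.card_fin] at this
      exact Nat.eq_sub_of_add_eq this
    · calc ∑ i, sInf {c : ℝ | ∃ X : Finset V, X.Nonempty ∧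
            X ⊆ (Finset.univ.filter fun v => f v = i) ∧ c = rhoW tl hd w Finset.univ X}
          ≤ ∑ i, rhoW tl hd w Finset.univ (e i : Finset V) :=
            Finset.sum_le_sum fun i _ => (hbdd _ (X i) (hXins i).1 fun v hv =>
              by simpa using hXf i hv).trans (hXle i)
        _ = ∑ Y : P, rhoW tl hd w Finset.univ (Y : Finset V) :=
            e.sum_comp fun Y : P => rhoW tl hd w Finset.univ (Y : Finset V)
        _ = _ := Finset.sum_coe_sort P _
  · rintro x ⟨F, Z, -, -, hZ, -, hZne, rfl⟩
    exact hlower' _ Z hZ hZne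
end

section
/- Separating edge for disjoint subtrees: Let T be a tree on a finite vertex set V, and let Z_1, …, Z_m (m ≥ 2) be pairwise disjoint non-empty vertex sets each inducing a subtree (connected subgraph) of T. Then there exists an edge e of T and a connected component C of T − e such that exactly one of the sets Z_i is contained in C and every other set Z_j (j ≠ i) is disjoint from C. -/
namespace SimpleGraph

variable {V : Type*} {G : SimpleGraph V}

/-- In a connected graph, every vertex other than `r` has a neighbour one step closer to `r`. -/
lemma Connected.exists_adj_dist_add_one (hG : G.Connected) {r v : V} (hv : v ≠ r) :
    ∃ p, G.Adj p v ∧ G.dist r p + 1 = G.dist r v := by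
  obtain ⟨w, hw⟩ := hG.exists_walk_length_eq_dist v r
  cases w with
  | nil => exact absurd rfl hv
  | @cons _ p _ h q =>
    refine ⟨p, h.symm, le_antisymm ?_ ?_⟩
    · have := dist_le q
      rw [Walk.length_cons] at hw
      rw [dist_comm, dist_comm (u := r)]
      omega
    · have := hG.dist_triangle (u := r) (v := p) (w := v)
      rwa [dist_eq_one_iff_adj.mpr h.symm] at this

/-- If `p` is the predecessor of `v` as seen from `r` and `pv` is a bridge, then every other vertex
on the side of `v` is farther from `r` than `v`. -/
lemma IsBridge.dist_lt_dist (hG : G.Connected) {r p v x : V} (hb : G.IsBridge s(p, v))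
    (hd : G.dist r p + 1 = G.dist r v) (hx : (G.deleteEdges {s(p, v)}).Reachable v x)
    (hxv : v ≠ x) : G.dist r v < G.dist r x := by
  classical
  have hrp : (G.deleteEdges {s(p, v)}).Reachable r p := by
    obtain ⟨w, hw⟩ := hG.exists_walk_length_eq_dist r p
    by_contra h
    have hv := w.snd_mem_support_of_mem_edges (w.mem_edges_of_not_reachable_deleteEdges h)
    have := dist_le (w.takeUntil v hv)
    have := w.length_takeUntil_le_length hv
    omega
  obtain ⟨w, hw⟩ := hG.exists_walk_length_eq_dist r x
  have hv : v ∈ w.support := by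
    refine w.snd_mem_support_of_mem_edges (t := p) (w.mem_edges_of_not_reachable_deleteEdges fun h ↦ ?_)
    exact isBridge_iff.mp hb (hrp.symm.trans (h.trans hx.symm))
  have h₁ := dist_le (w.takeUntil v hv)
  have h₂ := w.length_takeUntil_lt_length hv hxv
  omega

/-- Deleting an edge not contained in a connected vertex set keeps that set connected. -/
lemma reachable_deleteEdges_of_connected_induce {s : Set V} (hs : (G.induce s).Connected)
    {p v a b : V} (h : p ∉ s ∨ v ∉ s) (ha : a ∈ s) (hb : b ∈ s) :
    (G.deleteEdges {s(p, v)}).Reachable a b := by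
  let f : G.induce s →g G.deleteEdges {s(p, v)} :=
    { toFun := Subtype.val
      map_rel' := by
        rintro ⟨x, hx⟩ ⟨y, hy⟩ hxy
        simp only [comap_adj, Function.Embedding.subtype_apply] at hxy
        simp only [deleteEdges_adj, Set.mem_singleton_iff, Sym2.eq_iff]
        refine ⟨hxy, ?_⟩
        rintro (⟨rfl, rfl⟩ | ⟨rfl, rfl⟩) <;> tauto }
  exact (hs.preconnected ⟨a, ha⟩ ⟨b, hb⟩).map f

end SimpleGraph

/-- **Separating edge for disjoint subtrees.**  If `Z_1, …, Z_m` (`m ≥ 2`) are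
pairwise disjoint non-empty vertex sets of a finite tree `T`, each inducing a
subtree of `T`, then there is an edge `e` of `T` and a connected component `C`
of `T - e` containing exactly one of the `Z_i` and disjoint from all others. -/
theorem separating_edge_for_disjoint_subtrees
    {V : Type*} [Fintype V] [DecidableEq V]
    (T : SimpleGraph V) (hT : T.IsTree)
    (m : ℕ) (hm : 2 ≤ m) (Z : Fin m → Finset V)
    (hne : ∀ i, (Z i).Nonempty)
    (hdisj : ∀ i j, i ≠ j → Disjoint (Z i) (Z j))
    (hconn : ∀ i, (T.induce ((Z i : Set V))).Connected) :
    ∃ e ∈ T.edgeSet, ∃ C : Set V, IsCompOf (T.deleteEdges {e}) C ∧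
      ∃ i : Fin m, (Z i : Set V) ⊆ C ∧
        ∀ j : Fin m, j ≠ i → Disjoint (Z j : Set V) C := by
  have hdisj' {i j : Fin m} (hij : i ≠ j) {x : V} (hi : x ∈ Z i) : x ∉ Z j :=
    Finset.disjoint_left.mp (hdisj i j hij) hi
  obtain ⟨r, hr⟩ := hne ⟨0, by omega⟩
  choose top htop hmin using fun i ↦ (Z i).exists_min_image (T.dist r) (hne i)
  obtain ⟨i, -, hmax⟩ := Finset.univ.exists_max_image (fun i ↦ T.dist r (top i))
    ⟨(⟨0, by omega⟩ : Fin m), Finset.mem_univ _⟩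
  have hir : top i ≠ r := by
    intro h
    have h₁ := hmax ⟨1, by omega⟩ (Finset.mem_univ _)
    rw [h, SimpleGraph.dist_self, Nat.le_zero, hT.connected.dist_eq_zero_iff] at h₁
    exact hdisj' (by simp) hr (h₁ ▸ htop _)
  obtain ⟨p, hp, hd⟩ := hT.connected.exists_adj_dist_add_one hir
  have hb : T.IsBridge s(p, top i) :=
    SimpleGraph.isAcyclic_iff_forall_isBridge.mp hT.isAcyclic hp
  have hpi : p ∉ Z i := fun h ↦ by
    have := hmin i p h
    omega
  refine ⟨s(p, top i), hp, _, ⟨top i, rfl⟩, i, fun x hx ↦ ?_, fun j hj ↦ ?_⟩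
  · exact SimpleGraph.reachable_deleteEdges_of_connected_induce (hconn i) (.inl hpi) (htop i) hx
  · refine Set.disjoint_left.mpr fun x hx hxC ↦ ?_
    have hij := hdisj' hj.symm (htop i)
    have hreach := hxC.trans <| SimpleGraph.reachable_deleteEdges_of_connected_induce (hconn j)
      (.inr hij) hx (htop j)
    have hlt := hb.dist_lt_dist hT.connected hd hreach fun h ↦ hij (h ▸ htop j)
    exact absurd (hmax j (Finset.mem_univ j)) hlt.not_ge
end
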